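/- Let n ≥ 3 and let K be a C¹ function on S^n such that, denoting by K̃(x) = K(x/|x|) its degree-zero homogeneous extension to ℝ^{n+1} \ {0}, the directional derivative D K̃(θ)[e_{n+1}] is nonnegative for all θ ∈ S^n and is not identically zero on S^n \ {n, s}, where e_{n+1} = (0,…,0,1). If v ∈ C²(S^n \ {n}) is positive, satisfies −L_{S^n} v(θ) = K(θ) v(θ)^{(n+2)/(n−2)} for all θ ∈ S^n \ {n}, and liminf_{θ → n} v(θ) > 0, then there exists a positive constant C₀ such that v(θ) ≥ C₀ d(θ, n)^{−(n−2)/2} for all θ ∈ S^n \ {n}, where d denotes the geodesic distance on S^n (d(θ, n) = arccos θ_{n+1}). In particular, the equation −L_{S^n} v = K v^{(n+2)/(n−2)}, v > 0, has no solution v ∈ C²(S^n). -/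

import Mathlib

open scoped BigOperators

/-- The Euclidean Laplacian of `u : ℝᵐ → ℝ` at `x`, as the sum of the pure second
derivatives in the standard coordinate directions. -/
noncomputable def eLaplacian {m : ℕ} (u : EuclideanSpace ℝ (Fin m) → ℝ)
    (x : EuclideanSpace ℝ (Fin m)) : ℝ :=
  ∑ i : Fin m, iteratedFDeriv ℝ 2 u x ![EuclideanSpace.single i 1, EuclideanSpace.single i 1]

/-- The Laplace–Beltrami operator on the unit sphere: apply the Euclidean Laplacian to the
degree-zero homogeneous extension `x ↦ v (x/|x|)` and evaluate at a point of the sphere. -/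
noncomputable def sphLaplacian {m : ℕ} (v : EuclideanSpace ℝ (Fin m) → ℝ)
    (θ : EuclideanSpace ℝ (Fin m)) : ℝ :=
  eLaplacian (fun x => v (‖x‖⁻¹ • x)) θ

section

open Filter Topology

section SecondDerivatives

variable {E : Type*} [NormedAddCommGroup E] [NormedSpace ℝ E]

/-- The second derivative of `f` at `x` along the line through `x` with direction `d`. -/
noncomputable def secondDirDeriv (f : E → ℝ) (x d : E) : ℝ :=
  iteratedDeriv 2 (fun s : ℝ => f (x + s • d)) 0

theorem iteratedDeriv_two_eq_deriv_deriv (f : ℝ → ℝ) : iteratedDeriv 2 f = deriv (deriv f) := by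
  rw [iteratedDeriv_eq_iterate]; rfl

theorem iteratedDeriv_two_of_hasDerivAt {f f' : ℝ → ℝ} {f'' s : ℝ}
    (h : ∀ᶠ r in 𝓝 s, HasDerivAt f (f' r) r) (h' : HasDerivAt f' f'' s) :
    iteratedDeriv 2 f s = f'' := by
  rw [iteratedDeriv_two_eq_deriv_deriv]
  have : deriv f =ᶠ[𝓝 s] f' := h.mono fun r hr => hr.deriv
  rw [this.deriv_eq, h'.deriv]

theorem hasDerivAt_comp_curve {G : E → ℝ} {γ γ' : ℝ → E} {γ'' : E} {s : ℝ}
    (hG : ContDiffAt ℝ 2 G (γ s)) (h : ∀ᶠ r in 𝓝 s, HasDerivAt γ (γ' r) r)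
    (h' : HasDerivAt γ' γ'' s) :
    (∀ᶠ r in 𝓝 s, HasDerivAt (fun r => G (γ r)) (fderiv ℝ G (γ r) (γ' r)) r) ∧
      HasDerivAt (fun r => fderiv ℝ G (γ r) (γ' r))
        (fderiv ℝ (fderiv ℝ G) (γ s) (γ' s) (γ' s) + fderiv ℝ G (γ s) γ'') s := by
  constructor
  · have hγ : ContinuousAt γ s := h.self_of_nhds.continuousAt
    have hev : ∀ᶠ y in 𝓝 (γ s), ContDiffAt ℝ 2 G y := hG.eventually (by simp)
    filter_upwards [h, hγ.eventually hev] with r hr hGr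
    exact (hGr.differentiableAt (by simp)).hasFDerivAt.comp_hasDerivAt r hr
  · have h2 : HasFDerivAt (fderiv ℝ G) (fderiv ℝ (fderiv ℝ G) (γ s)) (γ s) :=
      ((hG.fderiv_right (m := 1) (by norm_num)).differentiableAt (by simp)).hasFDerivAt
    exact (h2.comp_hasDerivAt s h.self_of_nhds).clm_apply h'

theorem iteratedDeriv_two_comp_curve {G : E → ℝ} {γ γ' : ℝ → E} {γ'' : E} {s : ℝ}
    (hG : ContDiffAt ℝ 2 G (γ s)) (h : ∀ᶠ r in 𝓝 s, HasDerivAt γ (γ' r) r)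
    (h' : HasDerivAt γ' γ'' s) :
    iteratedDeriv 2 (fun r => G (γ r)) s
      = fderiv ℝ (fderiv ℝ G) (γ s) (γ' s) (γ' s) + fderiv ℝ G (γ s) γ'' :=
  let H := hasDerivAt_comp_curve hG h h'
  iteratedDeriv_two_of_hasDerivAt H.1 H.2

theorem secondDirDeriv_eq_fderiv {f : E → ℝ} {x : E} (hf : ContDiffAt ℝ 2 f x) (d : E) :
    secondDirDeriv f x d = fderiv ℝ (fderiv ℝ f) x d d := by
  have h : ∀ r : ℝ, HasDerivAt (fun s : ℝ => x + s • d) d r := fun r => by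
    simpa using ((hasDerivAt_id r).smul_const d).const_add x
  have := iteratedDeriv_two_comp_curve (G := f) (γ := fun s : ℝ => x + s • d) (γ' := fun _ => d)
    (γ'' := 0) (s := 0) (by simpa using hf) (Eventually.of_forall h) (hasDerivAt_const _ _)
  simpa [secondDirDeriv] using this

theorem contDiffAt_comp_line {f : E → ℝ} {x : E} (hf : ContDiffAt ℝ 2 f x) (d : E) :
    ContDiffAt ℝ 2 (fun s : ℝ => f (x + s • d)) 0 := by
  have hf' : ContDiffAt ℝ 2 f (x + (0 : ℝ) • d) := by simpa using hf
  exact hf'.comp (0 : ℝ) (f := fun s : ℝ => x + s • d) (by fun_prop)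

theorem secondDirDeriv_sub {f g : E → ℝ} {x : E} (hf : ContDiffAt ℝ 2 f x)
    (hg : ContDiffAt ℝ 2 g x) (d : E) :
    secondDirDeriv (fun y => f y - g y) x d = secondDirDeriv f x d - secondDirDeriv g x d :=
  iteratedDeriv_fun_sub (contDiffAt_comp_line hf d) (contDiffAt_comp_line hg d)

theorem secondDirDeriv_smul {f : E → ℝ} {x : E} (hf : ContDiffAt ℝ 2 f x) (c : ℝ) (d : E) :
    secondDirDeriv f x (c • d) = c ^ 2 * secondDirDeriv f x d := by
  simp only [secondDirDeriv_eq_fderiv hf, map_smul, smul_eq_mul, smul_apply]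
  ring

theorem IsLocalMin.iteratedDeriv_two_nonneg {φ : ℝ → ℝ} {s : ℝ} (hφ : ContDiffAt ℝ 2 φ s)
    (h : IsLocalMin φ s) : 0 ≤ iteratedDeriv 2 φ s := by
  rw [iteratedDeriv_two_eq_deriv_deriv]
  by_contra! hneg
  have hmax := isLocalMax_of_deriv_deriv_neg hneg h.deriv_eq_zero hφ.continuousAt
  have hc : φ =ᶠ[𝓝 s] fun _ => φ s := by
    filter_upwards [h, hmax] with r h1 h2 using le_antisymm h2 h1
  have : deriv (deriv φ) s = 0 := by
    rw [hc.deriv.deriv_eq]; simp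
  exact hneg.ne this

theorem IsLocalMin.secondDirDeriv_nonneg {f : E → ℝ} {x : E} (hf : ContDiffAt ℝ 2 f x)
    (h : IsLocalMin f x) (d : E) : 0 ≤ secondDirDeriv f x d := by
  refine IsLocalMin.iteratedDeriv_two_nonneg (contDiffAt_comp_line hf d) ?_
  have hc : Tendsto (fun s : ℝ => x + s • d) (𝓝 0) (𝓝 x) := by
    have : Continuous fun s : ℝ => x + s • d := by fun_prop
    simpa using this.tendsto 0
  have := hc.eventually h
  simpa [IsLocalMin, IsMinFilter] using this

end SecondDerivatives

section Cylinder

variable {n : ℕ}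

/-- On functions that are homogeneous of degree zero in the first variable, this is the
Laplacian of the cylinder `S^{n-1} × ℝ`. -/
noncomputable def cylLaplacian (f : EuclideanSpace ℝ (Fin n) × ℝ → ℝ)
    (x : EuclideanSpace ℝ (Fin n) × ℝ) : ℝ :=
  ‖x.1‖ ^ 2 * ∑ i : Fin n, secondDirDeriv f x (EuclideanSpace.single i 1, 0)
    + secondDirDeriv f x (0, 1)

theorem cylLaplacian_sub {f g : EuclideanSpace ℝ (Fin n) × ℝ → ℝ}
    {x : EuclideanSpace ℝ (Fin n) × ℝ} (hf : ContDiffAt ℝ 2 f x) (hg : ContDiffAt ℝ 2 g x) :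
    cylLaplacian (fun y => f y - g y) x = cylLaplacian f x - cylLaplacian g x := by
  simp only [cylLaplacian, secondDirDeriv_sub hf hg, Finset.sum_sub_distrib]
  ring

theorem IsLocalMin.cylLaplacian_nonneg {f : EuclideanSpace ℝ (Fin n) × ℝ → ℝ}
    {x : EuclideanSpace ℝ (Fin n) × ℝ} (hf : ContDiffAt ℝ 2 f x) (h : IsLocalMin f x) :
    0 ≤ cylLaplacian f x :=
  add_nonneg (mul_nonneg (sq_nonneg _) (Finset.sum_nonneg fun _ _ => h.secondDirDeriv_nonneg hf _))
    (h.secondDirDeriv_nonneg hf _)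

theorem cylLaplacian_comp_reflection (f : EuclideanSpace ℝ (Fin n) × ℝ → ℝ) (l : ℝ)
    (x : EuclideanSpace ℝ (Fin n) × ℝ) :
    cylLaplacian (fun y => f (y.1, 2 * l - y.2)) x = cylLaplacian f (x.1, 2 * l - x.2) := by
  unfold cylLaplacian
  congr 1
  · simp [secondDirDeriv]
  · have := iteratedDeriv_comp_neg 2 (fun s : ℝ => f ((x.1, 2 * l - x.2) + s • (0, 1))) 0
    simp only [secondDirDeriv]
    simp only [Prod.smul_mk, smul_zero, smul_eq_mul, mul_one, Prod.mk_add_mk, add_zero, neg_zero,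
      even_two, Even.neg_pow, one_pow, one_mul, Prod.fst_add, Prod.snd_add] at this ⊢
    rw [← this]
    congr 1
    ext s
    congr 2
    ring

theorem iteratedDeriv_two_cos_affine (b T c t : ℝ) :
    iteratedDeriv 2 (fun s : ℝ => c * Real.cos (b * (t + s - T))) 0
      = -(b ^ 2 * (c * Real.cos (b * (t - T)))) := by
  have h1 : ∀ r : ℝ, HasDerivAt (fun s : ℝ => b * (t + s - T)) b r := fun r => by
    simpa using (((hasDerivAt_id r).const_add t).sub_const T).const_mul b
  refine (iteratedDeriv_two_of_hasDerivAt (f' := fun s => c * (-Real.sin (b * (t + s - T)) * b))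
    (Eventually.of_forall fun r => (h1 r).cos.const_mul c)
    ((((h1 0).sin.neg).mul_const b).const_mul c)).trans ?_
  simp only [add_zero]
  ring

theorem cylLaplacian_cos (b T c : ℝ) (x : EuclideanSpace ℝ (Fin n) × ℝ) :
    cylLaplacian (fun y => c * Real.cos (b * (y.2 - T))) x
      = -(b ^ 2 * (c * Real.cos (b * (x.2 - T)))) := by
  have h := iteratedDeriv_two_cos_affine b T c x.2
  simp only [cylLaplacian, secondDirDeriv, Prod.snd_add, Prod.smul_snd, smul_eq_mul, mul_one, h]
  simp [iteratedDeriv_const, -iteratedDeriv_const_mul_field]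

theorem isOpen_fst_ne_zero : IsOpen {x : EuclideanSpace ℝ (Fin n) × ℝ | x.1 ≠ 0} :=
  isOpen_ne_fun continuous_fst continuous_const

/-- Comparison with a positive function of the axial variable on a slab of the cylinder. -/
theorem exists_cylLaplacian_ge_of_neg {z : EuclideanSpace ℝ (Fin n) × ℝ → ℝ}
    (hz : ContDiffOn ℝ 2 z {x | x.1 ≠ 0})
    (hhom : ∀ c : ℝ, 0 < c → ∀ x, z (c • x.1, x.2) = z x)
    {T T' b : ℝ} (hb : 0 ≤ b) (hbT : b * (T' - T) < Real.pi / 2)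
    {x₀ : EuclideanSpace ℝ (Fin n) × ℝ} (hx₀ : x₀.1 ≠ 0) (hT : T < x₀.2) (hT' : x₀.2 < T')
    (hneg : z x₀ < 0)
    (hbd : ∀ x : EuclideanSpace ℝ (Fin n) × ℝ, x.1 ≠ 0 → x.2 = T ∨ x.2 = T' →
      z x₀ * Real.cos (b * (x.2 - T)) < z x * Real.cos (b * (x₀.2 - T))) :
    ∃ x : EuclideanSpace ℝ (Fin n) × ℝ, x.1 ≠ 0 ∧ T < x.2 ∧ x.2 < T' ∧ z x < 0 ∧
      -(b ^ 2 * z x) ≤ cylLaplacian z x := by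
  have hcos : ∀ t, T ≤ t → t ≤ T' → 0 < Real.cos (b * (t - T)) := fun t h1 h2 => by
    apply Real.cos_pos_of_mem_Ioo
    constructor
    · have : 0 ≤ b * (t - T) := mul_nonneg hb (by linarith)
      linarith [Real.pi_pos]
    · have : b * (t - T) ≤ b * (T' - T) := mul_le_mul_of_nonneg_left (by linarith) hb
      linarith
  set Q : Set (EuclideanSpace ℝ (Fin n) × ℝ) := Metric.sphere 0 1 ×ˢ Set.Icc T T' with hQ
  have hQc : IsCompact Q := (isCompact_sphere _ _).prod isCompact_Icc
  have hQne : ∀ x ∈ Q, x.1 ≠ 0 := fun x hx => by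
    have : ‖x.1‖ = 1 := by simpa using hx.1
    intro h; simp [h] at this
  have hnorm : ∀ x : EuclideanSpace ℝ (Fin n) × ℝ, x.1 ≠ 0 → T ≤ x.2 → x.2 ≤ T' →
      (‖x.1‖⁻¹ • x.1, x.2) ∈ Q ∧ z (‖x.1‖⁻¹ • x.1, x.2) = z x := fun x hx h1 h2 => by
    have hp : 0 < ‖x.1‖ := norm_pos_iff.2 hx
    refine ⟨⟨?_, h1, h2⟩, hhom _ (inv_pos.2 hp) x⟩
    simp [norm_smul, hp.ne']
  have hcont : ContinuousOn (fun x => z x / Real.cos (b * (x.2 - T))) Q := by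
    refine ContinuousOn.div (hz.continuousOn.mono hQne) (by fun_prop) fun x hx => ?_
    exact (hcos x.2 hx.2.1 hx.2.2).ne'
  obtain ⟨x₁, hx₁, hmin⟩ := hQc.exists_isMinOn ⟨_, (hnorm x₀ hx₀ hT.le hT'.le).1⟩ hcont
  set c := z x₁ / Real.cos (b * (x₁.2 - T)) with hc
  have hle : ∀ x : EuclideanSpace ℝ (Fin n) × ℝ, x.1 ≠ 0 → T ≤ x.2 → x.2 ≤ T' →
      c * Real.cos (b * (x.2 - T)) ≤ z x := fun x hx h1 h2 => by
    obtain ⟨hm, he⟩ := hnorm x hx h1 h2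
    have : c ≤ z (‖x.1‖⁻¹ • x.1, x.2) / Real.cos (b * (x.2 - T)) := hmin hm
    rw [he, le_div_iff₀ (hcos _ h1 h2)] at this
    exact this
  have h0 := hcos x₀.2 hT.le hT'.le
  have h1 := hcos x₁.2 hx₁.2.1 hx₁.2.2
  have hc0 : c < 0 := by
    have := hle x₀ hx₀ hT.le hT'.le
    by_contra! h
    nlinarith [mul_nonneg h h0.le]
  have hz1 : z x₁ = c * Real.cos (b * (x₁.2 - T)) := by
    rw [hc]; field_simp
  have hint : ¬ (x₁.2 = T ∨ x₁.2 = T') := fun h => by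
    have h2 := hbd x₁ (hQne _ hx₁) h
    have h3 := hle x₀ hx₀ hT.le hT'.le
    rw [hz1] at h2
    nlinarith [mul_le_mul_of_nonneg_right h3 h1.le]
  push Not at hint
  have hl : T < x₁.2 := lt_of_le_of_ne hx₁.2.1 (Ne.symm hint.1)
  have hr : x₁.2 < T' := lt_of_le_of_ne hx₁.2.2 hint.2
  have hzc : ContDiffAt ℝ 2 z x₁ := hz.contDiffAt (isOpen_fst_ne_zero.mem_nhds (hQne _ hx₁))
  have hgc : ContDiffAt ℝ 2
      (fun y : EuclideanSpace ℝ (Fin n) × ℝ => c * Real.cos (b * (y.2 - T))) x₁ := by fun_prop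
  refine ⟨x₁, hQne _ hx₁, hl, hr, ?_, ?_⟩
  · rw [hz1]; exact mul_neg_of_neg_of_pos hc0 h1
  have hloc : IsLocalMin (fun y => z y - c * Real.cos (b * (y.2 - T))) x₁ := by
    have e1 : ∀ᶠ y : EuclideanSpace ℝ (Fin n) × ℝ in 𝓝 x₁, y.1 ≠ 0 :=
      isOpen_fst_ne_zero.mem_nhds (hQne _ hx₁)
    have e2 : ∀ᶠ y : EuclideanSpace ℝ (Fin n) × ℝ in 𝓝 x₁, y.2 ∈ Set.Ioo T T' :=
      continuous_snd.continuousAt.eventually (isOpen_Ioo.mem_nhds ⟨hl, hr⟩)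
    filter_upwards [e1, e2] with y h1 h2
    have := hle y h1 h2.1.le h2.2.le
    simp only [hz1]
    linarith
  have := hloc.cylLaplacian_nonneg (hzc.sub hgc)
  rw [cylLaplacian_sub hzc hgc, cylLaplacian_cos, ← hz1] at this
  linarith

end Cylinder

section StrongMaximumPrinciple

variable {n : ℕ}

theorem iteratedDeriv_two_gaussian (ε α k q u : ℝ) :
    iteratedDeriv 2 (fun s : ℝ => ε * (Real.exp (-(α * (q + 2 * u * s + s ^ 2))) - k)) 0
      = ε * Real.exp (-(α * q)) * (4 * α ^ 2 * u ^ 2 - 2 * α) := by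
  have h1 : ∀ r : ℝ, HasDerivAt (fun s : ℝ => -(α * (q + 2 * u * s + s ^ 2)))
      (-(α * (2 * u + 2 * r))) r := fun r => by
    have := ((((hasDerivAt_id r).const_mul (2 * u)).const_add q).add
      ((hasDerivAt_id r).pow 2)).const_mul α |>.neg
    refine this.congr_deriv ?_
    simp
  have h2 : ∀ r : ℝ, HasDerivAt (fun s : ℝ => -(α * (2 * u + 2 * s))) (-(α * 2)) r := fun r => by
    have := ((((hasDerivAt_id r).const_mul 2).const_add (2 * u)).const_mul α).neg
    exact this.congr_deriv (by ring)
  refine (iteratedDeriv_two_of_hasDerivAt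
    (Eventually.of_forall fun r => ((h1 r).exp.sub_const k).const_mul ε)
    (((h1 0).exp.mul (h2 0)).const_mul ε)).trans ?_
  simp only [mul_zero, add_zero, ne_eq, OfNat.ofNat_ne_zero, not_false_eq_true, zero_pow]
  ring

theorem cylLaplacian_gaussian (ε α k : ℝ) (c x : EuclideanSpace ℝ (Fin n) × ℝ) :
    cylLaplacian (fun y => ε * (Real.exp (-(α * (‖y.1 - c.1‖ ^ 2 + (y.2 - c.2) ^ 2))) - k)) x
      = ε * Real.exp (-(α * (‖x.1 - c.1‖ ^ 2 + (x.2 - c.2) ^ 2))) *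
        (‖x.1‖ ^ 2 * (4 * α ^ 2 * ‖x.1 - c.1‖ ^ 2 - 2 * α * n)
          + (4 * α ^ 2 * (x.2 - c.2) ^ 2 - 2 * α)) := by
  have e1 : ∀ i : Fin n, secondDirDeriv (fun y : EuclideanSpace ℝ (Fin n) × ℝ =>
      ε * (Real.exp (-(α * (‖y.1 - c.1‖ ^ 2 + (y.2 - c.2) ^ 2))) - k)) x
        (EuclideanSpace.single i 1, 0)
      = ε * Real.exp (-(α * (‖x.1 - c.1‖ ^ 2 + (x.2 - c.2) ^ 2))) *
        (4 * α ^ 2 * ((x.1 - c.1) i) ^ 2 - 2 * α) := fun i => by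
    rw [← iteratedDeriv_two_gaussian ε α k]
    unfold secondDirDeriv
    congr 1
    ext s
    have : x.1 + s • EuclideanSpace.single i (1 : ℝ) - c.1
        = (x.1 - c.1) + s • EuclideanSpace.single i (1 : ℝ) := by abel
    simp only [Prod.fst_add, Prod.snd_add, Prod.smul_fst, Prod.smul_snd, smul_zero, add_zero, this]
    rw [norm_add_sq_real, norm_smul, inner_smul_right, EuclideanSpace.inner_single_right]
    simp only [PiLp.norm_single, Real.norm_eq_abs, abs_one, mul_one, sq_abs, one_mul,
      conj_trivial]
    congr 4
    ring
  have e2 : secondDirDeriv (fun y : EuclideanSpace ℝ (Fin n) × ℝ =>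
      ε * (Real.exp (-(α * (‖y.1 - c.1‖ ^ 2 + (y.2 - c.2) ^ 2))) - k)) x (0, 1)
      = ε * Real.exp (-(α * (‖x.1 - c.1‖ ^ 2 + (x.2 - c.2) ^ 2))) *
        (4 * α ^ 2 * (x.2 - c.2) ^ 2 - 2 * α) := by
    rw [← iteratedDeriv_two_gaussian ε α k]
    unfold secondDirDeriv
    congr 1
    ext s
    simp only [Prod.fst_add, Prod.snd_add, Prod.smul_fst, Prod.smul_snd, smul_zero, add_zero,
      smul_eq_mul, mul_one]
    congr 4
    ring
  have e3 : ‖x.1 - c.1‖ ^ 2 = ∑ i, ((x.1 - c.1) i) ^ 2 := by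
    rw [EuclideanSpace.norm_sq_eq]; simp
  simp only [cylLaplacian, e1, e2]
  rw [← Finset.mul_sum, Finset.sum_sub_distrib, ← Finset.mul_sum, ← e3]
  simp only [Finset.sum_const, Finset.card_univ, Fintype.card_fin, nsmul_eq_mul]
  ring

/-- A nonnegative supersolution that is positive at a point is positive on a whole ball. -/
theorem pos_of_pos_center {z : EuclideanSpace ℝ (Fin n) × ℝ → ℝ}
    {c : EuclideanSpace ℝ (Fin n) × ℝ} {R C : ℝ} (hR : 0 < R)
    (hz : ∀ x ∈ Metric.closedBall c R, ContDiffAt ℝ 2 z x)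
    (hΩ : ∀ x ∈ Metric.closedBall c R, x.1 ≠ 0)
    (hz0 : ∀ x ∈ Metric.closedBall c R, 0 ≤ z x) (hC : 0 < C)
    (hzC : ∀ x ∈ Metric.closedBall c R, cylLaplacian z x ≤ C * z x) (hzc : 0 < z c)
    {x : EuclideanSpace ℝ (Fin n) × ℝ} (hx : ‖x.1 - c.1‖ ^ 2 + (x.2 - c.2) ^ 2 < R ^ 2) :
    0 < z x := by
  set q : EuclideanSpace ℝ (Fin n) × ℝ → ℝ :=
    fun y => ‖y.1 - c.1‖ ^ 2 + (y.2 - c.2) ^ 2 with hq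
  have hqc : Continuous q := by fun_prop
  have hqball : ∀ r, 0 ≤ r → ∀ y, q y ≤ r ^ 2 → dist y c ≤ r := fun r hr y hy => by
    rw [Prod.dist_eq, max_le_iff, dist_eq_norm, Real.dist_eq]
    constructor
    · exact abs_le_of_sq_le_sq' (by simp only [hq] at hy; nlinarith [sq_nonneg (y.2 - c.2)]) hr |>.2
    · exact abs_le_of_sq_le_sq (by simp only [hq] at hy; nlinarith [sq_nonneg ‖y.1 - c.1‖]) hr
  obtain ⟨r, hr, hrz⟩ : ∃ r > 0, ∀ y, q y ≤ r → z c / 2 < z y := by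
    have hcont : ContinuousAt z c := (hz c (Metric.mem_closedBall_self hR.le)).continuousAt
    obtain ⟨ρ, hρ, h⟩ := Metric.eventually_nhds_iff.1
      (hcont.eventually (lt_mem_nhds (half_lt_self hzc)))
    refine ⟨(ρ / 2) ^ 2, by positivity, fun y hy => h ?_⟩
    linarith [hqball _ (by positivity) y hy]
  obtain ⟨m, hm, hm1, hmx⟩ : ∃ m > 0, m ≤ 1 ∧ ∀ y ∈ Metric.closedBall c R, m ≤ ‖y.1‖ ^ 2 := by
    obtain ⟨y, hy, hmin⟩ := (isCompact_closedBall c R).exists_isMinOn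
      ⟨c, Metric.mem_closedBall_self hR.le⟩
      (f := fun y : EuclideanSpace ℝ (Fin n) × ℝ => ‖y.1‖ ^ 2) (by fun_prop)
    have : 0 < ‖y.1‖ := norm_pos_iff.2 (hΩ y hy)
    exact ⟨min (‖y.1‖ ^ 2) 1, by positivity, min_le_right _ _,
      fun y' hy' => (min_le_left _ _).trans (hmin hy')⟩
  obtain ⟨M, hM⟩ : ∃ M, ∀ y ∈ Metric.closedBall c R, ‖y.1‖ ^ 2 ≤ M := by
    obtain ⟨M, hM⟩ := ((isCompact_closedBall c R).image
      (f := fun y : EuclideanSpace ℝ (Fin n) × ℝ => ‖y.1‖ ^ 2) (by fun_prop)).bddAbove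
    exact ⟨M, fun y hy => hM ⟨y, hy, rfl⟩⟩
  have hM0 : 0 < M := (hm.trans_le (hmx c (Metric.mem_closedBall_self hR.le))).trans_le
    (hM c (Metric.mem_closedBall_self hR.le))
  set α : ℝ := 1 + (2 * (M * n + 1) + C) / (4 * m * r) with hα
  have hα1 : 1 ≤ α := by rw [hα]; have : 0 ≤ (2 * (M * n + 1) + C) / (4 * m * r) := by positivity
                         linarith
  have hαm : 2 * (M * n + 1) + C ≤ α * (4 * m * r) := by
    have : (2 * (M * n + 1) + C) / (4 * m * r) * (4 * m * r) = 2 * (M * n + 1) + C := by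
      field_simp
    rw [hα, add_mul, this]
    have : 0 < 4 * m * r := by positivity
    linarith
  set k := Real.exp (-(α * R ^ 2)) with hk
  set h : EuclideanSpace ℝ (Fin n) × ℝ → ℝ :=
    fun y => z c / 2 * (Real.exp (-(α * q y)) - k) with hh
  have hhc : ∀ y, ContDiffAt ℝ 2 h y := fun y => by
    have h1 : ContDiff ℝ 2 fun y : EuclideanSpace ℝ (Fin n) × ℝ => ‖y.1 - c.1‖ ^ 2 :=
      (contDiff_fst.sub contDiff_const).norm_sq ℝ
    have : ContDiff ℝ 2 h := by
      simp only [hh, hq]; fun_prop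
    exact this.contDiffAt
  have hhL : ∀ y ∈ Metric.closedBall c R, r ≤ q y → C * h y ≤ cylLaplacian h y := fun y hy hry => by
    have e : cylLaplacian h y = z c / 2 * Real.exp (-(α * q y)) *
        (‖y.1‖ ^ 2 * (4 * α ^ 2 * ‖y.1 - c.1‖ ^ 2 - 2 * α * n)
          + (4 * α ^ 2 * (y.2 - c.2) ^ 2 - 2 * α)) := cylLaplacian_gaussian _ _ _ _ _
    have h1 : C ≤ ‖y.1‖ ^ 2 * (4 * α ^ 2 * ‖y.1 - c.1‖ ^ 2 - 2 * α * n)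
          + (4 * α ^ 2 * (y.2 - c.2) ^ 2 - 2 * α) := by
      have a1 : m * ‖y.1 - c.1‖ ^ 2 ≤ ‖y.1‖ ^ 2 * ‖y.1 - c.1‖ ^ 2 :=
        mul_le_mul_of_nonneg_right (hmx y hy) (sq_nonneg _)
      have a2 : m * (y.2 - c.2) ^ 2 ≤ (y.2 - c.2) ^ 2 := by
        nlinarith [sq_nonneg (y.2 - c.2)]
      have a3 : ‖y.1‖ ^ 2 * n ≤ M * n := mul_le_mul_of_nonneg_right (hM y hy) (Nat.cast_nonneg n)
      have a4 : m * r ≤ ‖y.1‖ ^ 2 * ‖y.1 - c.1‖ ^ 2 + (y.2 - c.2) ^ 2 := by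
        have : m * r ≤ m * q y := mul_le_mul_of_nonneg_left hry hm.le
        simp only [hq, mul_add] at this
        linarith
      have a5 : 4 * α ^ 2 * (m * r) ≤
          4 * α ^ 2 * (‖y.1‖ ^ 2 * ‖y.1 - c.1‖ ^ 2 + (y.2 - c.2) ^ 2) :=
        mul_le_mul_of_nonneg_left a4 (by positivity)
      have a6 : 2 * α * (‖y.1‖ ^ 2 * n) ≤ 2 * α * (M * n) :=
        mul_le_mul_of_nonneg_left a3 (by positivity)
      have a7 : α * (2 * (M * n + 1) + C) ≤ α * (α * (4 * m * r)) :=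
        mul_le_mul_of_nonneg_left hαm (by positivity)
      have a8 : C ≤ α * C := by nlinarith
      nlinarith
    rw [e]
    have h2 : h y ≤ z c / 2 * Real.exp (-(α * q y)) := by
      simp only [hh]
      exact mul_le_mul_of_nonneg_left (by linarith [Real.exp_pos (-(α * R ^ 2))]) (by positivity)
    have h3 : 0 ≤ z c / 2 * Real.exp (-(α * q y)) := by positivity
    calc C * h y ≤ C * (z c / 2 * Real.exp (-(α * q y))) := mul_le_mul_of_nonneg_left h2 hC.le
      _ = z c / 2 * Real.exp (-(α * q y)) * C := by ring
      _ ≤ _ := mul_le_mul_of_nonneg_left h1 h3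
  have hcmp : ∀ y, q y ≤ R ^ 2 → h y ≤ z y := by
    by_contra! hcon
    obtain ⟨y, hy, hyz⟩ := hcon
    have hQb : {y | q y ≤ R ^ 2} ⊆ Metric.closedBall c R := fun y hy => hqball R hR.le y hy
    have hQ : IsCompact {y | q y ≤ R ^ 2} :=
      (isCompact_closedBall c R).of_isClosed_subset (isClosed_le hqc continuous_const) hQb
    obtain ⟨p, hp, hmin⟩ := hQ.exists_isMinOn ⟨y, hy⟩ (f := fun y => z y - h y)
      fun y hy => ((hz y (hQb hy)).continuousAt.sub (hhc y).continuousAt).continuousWithinAt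
    have hneg : z p - h p < 0 := (hmin hy : z p - h p ≤ z y - h y).trans_lt (by linarith)
    have hpR : q p < R ^ 2 := by
      refine lt_of_le_of_ne hp fun he => ?_
      have : h p = 0 := by simp [hh, he, hk]
      linarith [hz0 p (hQb hp)]
    have hpr : r ≤ q p := by
      by_contra! hlt
      have h1 := hrz p hlt.le
      have h2 : h p ≤ z c / 2 := by
        have : Real.exp (-(α * q p)) ≤ 1 := Real.exp_le_one_iff.2 (by
          have : 0 ≤ q p := by simp only [hq]; positivity
          have : 0 ≤ α * q p := by positivity
          linarith)
        have h3 : Real.exp (-(α * q p)) - k ≤ 1 := by linarith [Real.exp_pos (-(α * R ^ 2))]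
        have := mul_le_mul_of_nonneg_left h3 (half_pos hzc).le
        simpa [hh] using this
      linarith
    have hloc : IsLocalMin (fun y => z y - h y) p :=
      hmin.isLocalMin (mem_of_superset ((isOpen_lt hqc continuous_const).mem_nhds hpR)
        fun y (h : q y < R ^ 2) => h.le)
    have h0 := hloc.cylLaplacian_nonneg ((hz p (hQb hp)).sub (hhc p))
    rw [cylLaplacian_sub (hz p (hQb hp)) (hhc p)] at h0
    have h1 := hzC p (hQb hp)
    have h2 := hhL p (hQb hp) hpr
    nlinarith
  refine lt_of_lt_of_le ?_ (hcmp x hx.le)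
  refine mul_pos (half_pos hzc) (sub_pos.2 (Real.exp_lt_exp.2 ?_))
  have : α * q x < α * R ^ 2 := mul_lt_mul_of_pos_left hx (by linarith)
  linarith

theorem pos_of_isPreconnected {z : EuclideanSpace ℝ (Fin n) × ℝ → ℝ}
    {D : Set (EuclideanSpace ℝ (Fin n) × ℝ)} (hD : IsOpen D) (hDc : IsPreconnected D)
    (hz : ∀ x ∈ D, ContDiffAt ℝ 2 z x) (hΩ : ∀ x ∈ D, x.1 ≠ 0) (hz0 : ∀ x ∈ D, 0 ≤ z x)
    (hzC : ∀ Q ⊆ D, IsCompact Q → ∃ C > 0, ∀ x ∈ Q, cylLaplacian z x ≤ C * z x)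
    {p : EuclideanSpace ℝ (Fin n) × ℝ} (hp : p ∈ D) (hzp : 0 < z p) :
    ∀ x ∈ D, 0 < z x := by
  have hu : IsOpen (D ∩ z ⁻¹' Set.Ioi 0) :=
    ContinuousOn.isOpen_inter_preimage (fun x hx => (hz x hx).continuousAt.continuousWithinAt)
      hD isOpen_Ioi
  refine fun x hx => (hDc.subset_of_closure_inter_subset hu ⟨p, hp, hp, hzp⟩ ?_ hx).2
  rintro x ⟨hxc, hxD⟩
  refine ⟨hxD, ?_⟩
  obtain ⟨ρ, hρ, hball⟩ := Metric.isOpen_iff.1 hD x hxD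
  obtain ⟨y, hy, hxy⟩ := Metric.mem_closure_iff.1 hxc (ρ / 8) (by positivity)
  have hsub : Metric.closedBall y (ρ / 2) ⊆ D := fun w hw => hball (by
    have h1 : dist w y ≤ ρ / 2 := hw
    have h2 := dist_triangle w y x
    rw [dist_comm y x] at h2
    exact Metric.mem_ball.2 (by linarith))
  obtain ⟨C, hC, hCz⟩ := hzC _ hsub (isCompact_closedBall _ _)
  refine pos_of_pos_center (half_pos hρ) (fun w hw => hz w (hsub hw)) (fun w hw => hΩ w (hsub hw))
    (fun w hw => hz0 w (hsub hw)) hC hCz hy.2 ?_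
  rw [Prod.dist_eq, max_lt_iff, dist_eq_norm, Real.dist_eq] at hxy
  have h2 : (x.2 - y.2) ^ 2 = |x.2 - y.2| ^ 2 := (sq_abs _).symm
  rw [h2]
  nlinarith [norm_nonneg (x.1 - y.1), abs_nonneg (x.2 - y.2)]

theorem isPreconnected_halfCylinder (hn : 2 ≤ n) (l : ℝ) :
    IsPreconnected {x : EuclideanSpace ℝ (Fin n) × ℝ | x.1 ≠ 0 ∧ l < x.2} := by
  have h : IsPreconnected ({(0 : EuclideanSpace ℝ (Fin n))}ᶜ : Set (EuclideanSpace ℝ (Fin n))) := by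
    refine (isConnected_compl_singleton_of_one_lt_rank ?_ _).isPreconnected
    rw [← Module.finrank_eq_rank, finrank_euclideanSpace_fin]
    exact_mod_cast hn
  exact h.prod (isPreconnected_Ioi (a := l))

end StrongMaximumPrinciple

section MovingPlanes

variable {n : ℕ}

/-- Positive solutions of `-Δw + a² w = k w ^ p` on the cylinder `S^{n-1} × ℝ` that decay at the
lower end, where `k` is bounded by `M` and monotone along the axis, and not symmetric under
any reflection. Functions on the cylinder are extended homogeneously of degree zero. -/
structure IsCylinderSolution (w k : EuclideanSpace ℝ (Fin n) × ℝ → ℝ) (a p M : ℝ) : Prop where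
  contDiffOn : ContDiffOn ℝ 2 w {x | x.1 ≠ 0}
  pos : ∀ x, x.1 ≠ 0 → 0 < w x
  hom : ∀ c : ℝ, 0 < c → ∀ x, w (c • x.1, x.2) = w x
  eqn : ∀ x, x.1 ≠ 0 → cylLaplacian w x = a ^ 2 * w x - k x * w x ^ p
  a_pos : 0 < a
  one_lt : 1 < p
  M_pos : 0 < M
  abs_k_le : ∀ x, x.1 ≠ 0 → |k x| ≤ M
  mono : ∀ y, y ≠ 0 → ∀ s t, s ≤ t → k (y, s) ≤ k (y, t)
  strict : ∀ l : ℝ, ∃ x, x.1 ≠ 0 ∧ l < x.2 ∧ k (x.1, 2 * l - x.2) < k x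
  decay : ∀ ε > 0, ∃ T : ℝ, ∀ x, x.1 ≠ 0 → x.2 ≤ T → w x ≤ ε

theorem rpow_sub_rpow_le {u v B p : ℝ} (hu : 0 ≤ u) (huv : u ≤ v) (hv : 0 < v) (hvB : v ≤ B)
    (hp : 1 ≤ p) : v ^ p - u ^ p ≤ p * B ^ (p - 1) * (v - u) := by
  have h1 : 1 + p * (u / v - 1) ≤ (1 + (u / v - 1)) ^ p :=
    one_add_mul_self_le_rpow_one_add (by have : 0 ≤ u / v := by positivity
                                         linarith) hp
  have h2 : (1 + (u / v - 1)) ^ p = u ^ p / v ^ p := by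
    rw [add_sub_cancel, Real.div_rpow hu hv.le]
  have hvp : 0 < v ^ p := Real.rpow_pos_of_pos hv p
  have h3 : v ^ p = v ^ (p - 1) * v := by
    rw [← Real.rpow_add_one hv.ne']; ring_nf
  have h4 : v ^ p * (1 + p * (u / v - 1)) ≤ u ^ p := by
    have := mul_le_mul_of_nonneg_left (h1.trans_eq h2) hvp.le
    rwa [mul_div_cancel₀ _ hvp.ne'] at this
  have h5 : v ^ p * (p * (u / v - 1)) = p * v ^ (p - 1) * (u - v) := by
    rw [h3]; field_simp
  have h6 : v ^ (p - 1) ≤ B ^ (p - 1) := Real.rpow_le_rpow hv.le hvB (by linarith)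
  have h7 : p * v ^ (p - 1) * (v - u) ≤ p * B ^ (p - 1) * (v - u) :=
    mul_le_mul_of_nonneg_right (mul_le_mul_of_nonneg_left h6 (by linarith)) (by linarith)
  nlinarith

/-- The difference of `w` and its reflection across the section of the cylinder at height `l`. -/
def reflDiff (w : EuclideanSpace ℝ (Fin n) × ℝ → ℝ) (l : ℝ)
    (x : EuclideanSpace ℝ (Fin n) × ℝ) : ℝ :=
  w x - w (x.1, 2 * l - x.2)

theorem reflDiff_of_eq (w : EuclideanSpace ℝ (Fin n) × ℝ → ℝ) {l : ℝ}
    {x : EuclideanSpace ℝ (Fin n) × ℝ} (hx : x.2 = l) : reflDiff w l x = 0 := by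
  have : (x.1, 2 * l - x.2) = x := by
    ext1
    · rfl
    · simp only [hx]; ring
  simp [reflDiff, this]

namespace IsCylinderSolution

variable {w k : EuclideanSpace ℝ (Fin n) × ℝ → ℝ} {a p M : ℝ}

theorem contDiffAt (hw : IsCylinderSolution w k a p M) {x : EuclideanSpace ℝ (Fin n) × ℝ}
    (hx : x.1 ≠ 0) : ContDiffAt ℝ 2 w x :=
  hw.contDiffOn.contDiffAt (isOpen_fst_ne_zero.mem_nhds hx)

theorem contDiffAt_comp_reflection (hw : IsCylinderSolution w k a p M) (l : ℝ)
    {x : EuclideanSpace ℝ (Fin n) × ℝ} (hx : x.1 ≠ 0) :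
    ContDiffAt ℝ 2 (fun y => w (y.1, 2 * l - y.2)) x :=
  (hw.contDiffAt (x := (x.1, 2 * l - x.2)) hx).comp x
    (f := fun y : EuclideanSpace ℝ (Fin n) × ℝ => (y.1, 2 * l - y.2)) (by fun_prop)

theorem contDiffAt_reflDiff (hw : IsCylinderSolution w k a p M) (l : ℝ)
    {x : EuclideanSpace ℝ (Fin n) × ℝ} (hx : x.1 ≠ 0) : ContDiffAt ℝ 2 (reflDiff w l) x :=
  (hw.contDiffAt hx).sub (hw.contDiffAt_comp_reflection l hx)

theorem contDiffOn_reflDiff (hw : IsCylinderSolution w k a p M) (l : ℝ) :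
    ContDiffOn ℝ 2 (reflDiff w l) {x | x.1 ≠ 0} :=
  fun _ hx => (hw.contDiffAt_reflDiff l hx).contDiffWithinAt

theorem hom_reflDiff (hw : IsCylinderSolution w k a p M) (l : ℝ) (c : ℝ) (hc : 0 < c)
    (x : EuclideanSpace ℝ (Fin n) × ℝ) : reflDiff w l (c • x.1, x.2) = reflDiff w l x := by
  simp only [reflDiff]
  rw [hw.hom c hc x, hw.hom c hc (x.1, 2 * l - x.2)]

theorem cylLaplacian_reflDiff (hw : IsCylinderSolution w k a p M) (l : ℝ)
    {x : EuclideanSpace ℝ (Fin n) × ℝ} (hx : x.1 ≠ 0) :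
    cylLaplacian (reflDiff w l) x = a ^ 2 * reflDiff w l x
      - (k x * w x ^ p - k (x.1, 2 * l - x.2) * w (x.1, 2 * l - x.2) ^ p) := by
  have := cylLaplacian_sub (hw.contDiffAt hx) (hw.contDiffAt_comp_reflection l hx)
  rw [cylLaplacian_comp_reflection, hw.eqn x hx, hw.eqn (x.1, 2 * l - x.2) hx] at this
  unfold reflDiff
  rw [this]
  ring

theorem cylLaplacian_reflDiff_le (hw : IsCylinderSolution w k a p M) {l : ℝ}
    {x : EuclideanSpace ℝ (Fin n) × ℝ} (hx : x.1 ≠ 0) (hl : l ≤ x.2) :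
    cylLaplacian (reflDiff w l) x ≤ a ^ 2 * reflDiff w l x
      - k x * (w x ^ p - w (x.1, 2 * l - x.2) ^ p) := by
  rw [hw.cylLaplacian_reflDiff l hx]
  have h1 : k (x.1, 2 * l - x.2) ≤ k x := hw.mono x.1 hx _ _ (by linarith)
  have h2 : 0 ≤ w (x.1, 2 * l - x.2) ^ p := Real.rpow_nonneg (hw.pos (x.1, 2 * l - x.2) hx).le _
  nlinarith [mul_le_mul_of_nonneg_right h1 h2]

theorem cylLaplacian_le_of_neg (hw : IsCylinderSolution w k a p M) {l B : ℝ}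
    {x : EuclideanSpace ℝ (Fin n) × ℝ} (hx : x.1 ≠ 0) (hl : l ≤ x.2)
    (hneg : reflDiff w l x < 0) (hB : w (x.1, 2 * l - x.2) ≤ B) :
    cylLaplacian (reflDiff w l) x ≤ (a ^ 2 - M * (p * B ^ (p - 1))) * reflDiff w l x := by
  refine (hw.cylLaplacian_reflDiff_le hx hl).trans ?_
  simp only [reflDiff] at hneg ⊢
  have h1 := rpow_sub_rpow_le (hw.pos x hx).le (by linarith)
    (hw.pos (x.1, 2 * l - x.2) hx) hB hw.one_lt.le
  have h2 : 0 ≤ w (x.1, 2 * l - x.2) ^ p - w x ^ p :=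
    sub_nonneg.2 (Real.rpow_le_rpow (hw.pos x hx).le (by linarith) (by linarith [hw.one_lt]))
  have h3 := mul_le_mul_of_nonneg_right (abs_le.1 (hw.abs_k_le x hx)).2 h2
  have h4 := mul_le_mul_of_nonneg_left h1 hw.M_pos.le
  nlinarith

theorem cylLaplacian_le_of_nonneg (hw : IsCylinderSolution w k a p M) {l B : ℝ}
    {x : EuclideanSpace ℝ (Fin n) × ℝ} (hx : x.1 ≠ 0) (hl : l ≤ x.2)
    (hnonneg : 0 ≤ reflDiff w l x) (hB : w x ≤ B) :
    cylLaplacian (reflDiff w l) x ≤ (a ^ 2 + M * (p * B ^ (p - 1))) * reflDiff w l x := by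
  refine (hw.cylLaplacian_reflDiff_le hx hl).trans ?_
  simp only [reflDiff] at hnonneg ⊢
  have h0 := hw.pos (x.1, 2 * l - x.2) hx
  have h1 := rpow_sub_rpow_le h0.le (by linarith) (hw.pos x hx) hB hw.one_lt.le
  have h2 : 0 ≤ w x ^ p - w (x.1, 2 * l - x.2) ^ p :=
    sub_nonneg.2 (Real.rpow_le_rpow h0.le (by linarith) (by linarith [hw.one_lt]))
  have h3 := mul_le_mul_of_nonneg_right (abs_le.1 (hw.abs_k_le x hx)).1 h2
  have h4 := mul_le_mul_of_nonneg_left h1 hw.M_pos.le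
  nlinarith

/-- Maximum principle in the region where the reflected solution is small. -/
theorem reflDiff_nonneg_of_small (hw : IsCylinderSolution w k a p M) {l T B : ℝ} (hlT : l ≤ T)
    (hB : M * (p * B ^ (p - 1)) < a ^ 2)
    (hsmall : ∀ x : EuclideanSpace ℝ (Fin n) × ℝ, x.1 ≠ 0 → T ≤ x.2 → w (x.1, 2 * l - x.2) ≤ B)
    (hbd : ∀ x : EuclideanSpace ℝ (Fin n) × ℝ, x.1 ≠ 0 → x.2 = T → 0 ≤ reflDiff w l x)
    {x : EuclideanSpace ℝ (Fin n) × ℝ} (hx : x.1 ≠ 0) (hxT : T ≤ x.2) :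
    0 ≤ reflDiff w l x := by
  by_contra! hneg
  have hlt : T < x.2 := lt_of_le_of_ne hxT fun h => absurd (hbd x hx h.symm) (not_le.2 hneg)
  obtain ⟨T₀, hT₀⟩ := hw.decay (-reflDiff w l x / 2) (by linarith)
  obtain ⟨x₁, hx₁, hT₁, -, hz₁, hL⟩ := exists_cylLaplacian_ge_of_neg
    (hw.contDiffOn_reflDiff l) (hw.hom_reflDiff l) (b := 0) (T := T)
    (T' := max (x.2 + 1) (2 * l - T₀)) le_rfl (by simpa using Real.pi_pos) hx hlt
    (lt_of_lt_of_le (lt_add_one _) (le_max_left _ _)) hneg (by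
      rintro y hy (h | h)
      · simpa using hneg.trans_le (hbd y hy h)
      · have h1 : w (y.1, 2 * l - y.2) ≤ -reflDiff w l x / 2 := by
          refine hT₀ (y.1, 2 * l - y.2) hy ?_
          have := le_max_right (x.2 + 1) (2 * l - T₀)
          simp only [h]
          linarith
        have h2 := hw.pos y hy
        have h3 : reflDiff w l y = w y - w (y.1, 2 * l - y.2) := rfl
        simp only [zero_mul, Real.cos_zero, mul_one]
        linarith)
  have h1 := hw.cylLaplacian_le_of_neg hx₁ (hlT.trans hT₁.le) hz₁ (hsmall x₁ hx₁ hT₁.le)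
  nlinarith

/-- Maximum principle in a narrow strip. -/
theorem reflDiff_nonneg_of_narrow (hw : IsCylinderSolution w k a p M) {l T B b : ℝ}
    (hb : 0 ≤ b) (hbB : M * (p * B ^ (p - 1)) < b ^ 2) (hbT : b * (T - l) < Real.pi / 2)
    (hbound : ∀ x : EuclideanSpace ℝ (Fin n) × ℝ, x.1 ≠ 0 → l ≤ x.2 → x.2 ≤ T →
      w (x.1, 2 * l - x.2) ≤ B)
    (hbd : ∀ x : EuclideanSpace ℝ (Fin n) × ℝ, x.1 ≠ 0 → x.2 = T → 0 ≤ reflDiff w l x)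
    {x : EuclideanSpace ℝ (Fin n) × ℝ} (hx : x.1 ≠ 0) (hxl : l ≤ x.2) (hxT : x.2 ≤ T) :
    0 ≤ reflDiff w l x := by
  by_contra! hneg
  have hltT : x.2 < T := lt_of_le_of_ne hxT fun h => absurd (hbd x hx h) (not_le.2 hneg)
  have hltl : l < x.2 := lt_of_le_of_ne hxl fun h => hneg.ne (reflDiff_of_eq w h.symm)
  have hcos : ∀ t, l ≤ t → t ≤ T → 0 < Real.cos (b * (t - l)) := fun t h1 h2 => by
    apply Real.cos_pos_of_mem_Ioo
    have : 0 ≤ b * (t - l) := mul_nonneg hb (by linarith)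
    have : b * (t - l) ≤ b * (T - l) := mul_le_mul_of_nonneg_left (by linarith) hb
    constructor <;> linarith [Real.pi_pos]
  obtain ⟨x₁, hx₁, hl₁, hT₁, hz₁, hL⟩ := exists_cylLaplacian_ge_of_neg
    (hw.contDiffOn_reflDiff l) (hw.hom_reflDiff l) hb hbT hx hltl hltT hneg (by
      intro y hy h
      have h1 : 0 ≤ reflDiff w l y := by
        rcases h with h | h
        · exact (reflDiff_of_eq w h).ge
        · exact hbd y hy h
      have h2 : 0 < Real.cos (b * (y.2 - l)) := by
        rcases h with h | h <;> rw [h]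
        · exact hcos l le_rfl (by linarith)
        · exact hcos T (by linarith) le_rfl
      exact (mul_neg_of_neg_of_pos hneg h2).trans_le (mul_nonneg h1 (hcos _ hxl hxT).le))
  have h1 := hw.cylLaplacian_le_of_neg hx₁ hl₁.le hz₁ (hbound x₁ hx₁ hl₁.le hT₁.le)
  nlinarith [mul_pos hw.a_pos hw.a_pos]

theorem exists_small (hw : IsCylinderSolution w k a p M) :
    ∃ B > 0, M * (p * B ^ (p - 1)) < a ^ 2 := by
  have hp : 0 < p := by linarith [hw.one_lt]
  have hM := hw.M_pos
  have ha := hw.a_pos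
  refine ⟨(a ^ 2 / (2 * M * p)) ^ (1 / (p - 1)), by positivity, ?_⟩
  rw [← Real.rpow_mul (by positivity), one_div_mul_cancel (by linarith [hw.one_lt]),
    Real.rpow_one]
  have : M * (p * (a ^ 2 / (2 * M * p))) = a ^ 2 / 2 := by field_simp
  rw [this]
  have : 0 < a ^ 2 := by positivity
  linarith

theorem reflDiff_pos (hw : IsCylinderSolution w k a p M) (hn : 2 ≤ n) {l : ℝ}
    (h0 : ∀ x : EuclideanSpace ℝ (Fin n) × ℝ, x.1 ≠ 0 → l ≤ x.2 → 0 ≤ reflDiff w l x)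
    {x : EuclideanSpace ℝ (Fin n) × ℝ} (hx : x.1 ≠ 0) (hl : l < x.2) :
    0 < reflDiff w l x := by
  have hD : IsOpen {x : EuclideanSpace ℝ (Fin n) × ℝ | x.1 ≠ 0 ∧ l < x.2} :=
    isOpen_fst_ne_zero.inter (isOpen_lt continuous_const continuous_snd)
  obtain ⟨q, hq, hlq, hkq⟩ := hw.strict l
  have hzq : 0 < reflDiff w l q := by
    refine lt_of_le_of_ne (h0 q hq hlq.le) fun he => ?_
    have hmin : IsLocalMin (reflDiff w l) q := by
      filter_upwards [hD.mem_nhds (show q ∈ {x : EuclideanSpace ℝ (Fin n) × ℝ | x.1 ≠ 0 ∧ l < x.2}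
        from ⟨hq, hlq⟩)] with y hy
      rw [← he]
      exact h0 y hy.1 hy.2.le
    have h1 := hmin.cylLaplacian_nonneg (hw.contDiffAt_reflDiff l hq)
    rw [hw.cylLaplacian_reflDiff l hq, ← he] at h1
    have h2 : w q = w (q.1, 2 * l - q.2) := by
      simp only [reflDiff] at he; linarith
    rw [← h2] at h1
    have h3 : 0 < w q ^ p := Real.rpow_pos_of_pos (hw.pos q hq) p
    nlinarith [mul_lt_mul_of_pos_right hkq h3]
  refine pos_of_isPreconnected hD (isPreconnected_halfCylinder hn l)
    (fun y hy => hw.contDiffAt_reflDiff l hy.1) (fun y hy => hy.1) (fun y hy => h0 y hy.1 hy.2.le)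
    ?_ ⟨hq, hlq⟩ hzq x ⟨hx, hl⟩
  intro Q hQD hQ
  obtain ⟨B, hB⟩ := (hQ.image_of_continuousOn
    (hw.contDiffOn.continuousOn.mono fun y hy => (hQD hy).1)).bddAbove
  have hp : 0 < p := by linarith [hw.one_lt]
  have hM := hw.M_pos
  have ha := hw.a_pos
  refine ⟨a ^ 2 + M * (p * (max B 1) ^ (p - 1)), by positivity, fun y hy => ?_⟩
  exact hw.cylLaplacian_le_of_nonneg (hQD hy).1 (hQD hy).2.le (h0 y (hQD hy).1 (hQD hy).2.le)
    ((hB ⟨y, hy, rfl⟩).trans (le_max_left _ _))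

theorem exists_bound (hw : IsCylinderSolution w k a p M) (s t : ℝ) :
    ∃ B > 0, ∀ x : EuclideanSpace ℝ (Fin n) × ℝ, x.1 ≠ 0 → s ≤ x.2 → x.2 ≤ t → w x ≤ B := by
  have hQ : IsCompact (Metric.sphere (0 : EuclideanSpace ℝ (Fin n)) 1 ×ˢ Set.Icc s t) :=
    (isCompact_sphere _ _).prod isCompact_Icc
  obtain ⟨B, hB⟩ := (hQ.image_of_continuousOn (f := w)
    (hw.contDiffOn.continuousOn.mono fun y hy => by
      have : ‖y.1‖ = 1 := by simpa using hy.1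
      intro h; simp [h] at this)).bddAbove
  refine ⟨max B 1, by positivity, fun x hx h1 h2 => le_max_of_le_left ?_⟩
  have hp : 0 < ‖x.1‖ := norm_pos_iff.2 hx
  rw [← hw.hom _ (inv_pos.2 hp) x]
  refine hB ⟨(‖x.1‖⁻¹ • x.1, x.2), ⟨?_, h1, h2⟩, rfl⟩
  simp [norm_smul, hp.ne']

theorem eventually_reflDiff_nonneg (hw : IsCylinderSolution w k a p M) {l : ℝ}
    (hpos : ∀ x : EuclideanSpace ℝ (Fin n) × ℝ, x.1 ≠ 0 → l < x.2 → 0 < reflDiff w l x) :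
    ∃ δ > 0, ∀ l', l < l' → l' < l + δ → ∀ x : EuclideanSpace ℝ (Fin n) × ℝ, x.1 ≠ 0 →
      l' ≤ x.2 → 0 ≤ reflDiff w l' x := by
  obtain ⟨ε, hε, hεa⟩ := hw.exists_small
  obtain ⟨S, hS⟩ := hw.decay ε hε
  obtain ⟨B, hB, hBw⟩ := hw.exists_bound (l - 1) (l + 1)
  have hp : 0 < p := by linarith [hw.one_lt]
  have hM := hw.M_pos
  set b := Real.sqrt (M * (p * B ^ (p - 1)) + 1) with hb
  have hb2 : b ^ 2 = M * (p * B ^ (p - 1)) + 1 := Real.sq_sqrt (by positivity)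
  have hb0 : 0 < b := Real.sqrt_pos.2 (by positivity)
  set η := min 1 (1 / b) with hη
  have hη0 : 0 < η := by positivity
  have hη1 : η ≤ 1 := min_le_left _ _
  have hbη : b * η ≤ 1 := by
    have : b * η ≤ b * (1 / b) := mul_le_mul_of_nonneg_left (min_le_right _ _) hb0.le
    rwa [mul_one_div_cancel hb0.ne'] at this
  set T := max (2 * (l + 1) - S) (l + 1) with hT
  set Q : Set (EuclideanSpace ℝ (Fin n) × ℝ) :=
    Metric.sphere (0 : EuclideanSpace ℝ (Fin n)) 1 ×ˢ Set.Icc (l + η) T with hQd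
  have hQ : IsCompact Q := (isCompact_sphere _ _).prod isCompact_Icc
  have hev : ∀ᶠ l' in 𝓝 l, ∀ x ∈ Q, 0 < reflDiff w l' x := by
    refine hQ.eventually_forall_of_forall_eventually (P := fun l' x => 0 < reflDiff w l' x)
      fun x hx => ?_
    have hx0 : x.1 ≠ 0 := by
      have : ‖x.1‖ = 1 := by simpa using hx.1
      intro h; simp [h] at this
    have hc : ContinuousAt (fun q : ℝ × (EuclideanSpace ℝ (Fin n) × ℝ) => reflDiff w q.1 q.2)
        (l, x) := by
      refine ContinuousAt.sub ?_ ?_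
      · exact ContinuousAt.comp (f := fun q : ℝ × (EuclideanSpace ℝ (Fin n) × ℝ) => q.2)
          (g := w) (hw.contDiffAt hx0).continuousAt continuousAt_snd
      · exact ContinuousAt.comp
          (f := fun q : ℝ × (EuclideanSpace ℝ (Fin n) × ℝ) => (q.2.1, 2 * q.1 - q.2.2))
          (g := w) (hw.contDiffAt (x := (x.1, 2 * l - x.2)) hx0).continuousAt (by fun_prop)
    exact hc.eventually (lt_mem_nhds (hpos x hx0 (by linarith [hx.2.1])))
  obtain ⟨δ, hδ, hδe⟩ := Metric.eventually_nhds_iff.1 hev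
  refine ⟨min δ η, by positivity, fun l' hl' hl'δ x hx hxl => ?_⟩
  have hl'1 : l' < l + δ := hl'δ.trans_le (by linarith [min_le_left δ η])
  have hl'2 : l' < l + η := hl'δ.trans_le (by linarith [min_le_right δ η])
  have hmid : ∀ y : EuclideanSpace ℝ (Fin n) × ℝ, y.1 ≠ 0 → l + η ≤ y.2 → y.2 ≤ T →
      0 ≤ reflDiff w l' y := fun y hy h1 h2 => by
    have hp : 0 < ‖y.1‖ := norm_pos_iff.2 hy
    rw [← hw.hom_reflDiff l' _ (inv_pos.2 hp) y]
    refine (hδe (y := l') (by rw [Real.dist_eq, abs_lt]; constructor <;> linarith)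
      (‖y.1‖⁻¹ • y.1, y.2) ⟨?_, h1, h2⟩).le
    simp [norm_smul, hp.ne']
  have hT1 : l + 1 ≤ T := le_max_right _ _
  have hT2 : 2 * (l + 1) - S ≤ T := le_max_left _ _
  rcases le_total x.2 (l + η) with h1 | h1
  · refine hw.reflDiff_nonneg_of_narrow (B := B) (T := l + η) hb0.le (by linarith) ?_ ?_
      (fun y hy h => hmid y hy h.ge (by linarith)) hx hxl h1
    · have : b * (l + η - l') ≤ b * η := mul_le_mul_of_nonneg_left (by linarith) hb0.le
      linarith [Real.pi_gt_three]
    · exact fun y hy h2 h3 => hBw (y.1, 2 * l' - y.2) hy (by simp only; linarith)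
        (by simp only; linarith)
  rcases le_total x.2 T with h2 | h2
  · exact hmid x hx h1 h2
  · refine hw.reflDiff_nonneg_of_small (by linarith) hεa ?_
      (fun y hy h => hmid y hy (by linarith) h.le) hx h2
    exact fun y hy h3 => hS (y.1, 2 * l' - y.2) hy (by simp only; linarith)

theorem reflDiff_nonneg (hw : IsCylinderSolution w k a p M) (hn : 2 ≤ n) (l : ℝ)
    {x : EuclideanSpace ℝ (Fin n) × ℝ} (hx : x.1 ≠ 0) (hl : l ≤ x.2) :
    0 ≤ reflDiff w l x := by
  by_contra! hcon
  set bad : Set ℝ := {l | ∃ x : EuclideanSpace ℝ (Fin n) × ℝ, x.1 ≠ 0 ∧ l ≤ x.2 ∧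
    reflDiff w l x < 0} with hbad
  have hne : bad.Nonempty := ⟨l, x, hx, hl, hcon⟩
  obtain ⟨ε, hε, hεa⟩ := hw.exists_small
  obtain ⟨S, hS⟩ := hw.decay ε hε
  have hbdd : BddBelow bad := by
    refine ⟨S, fun l' hl' => ?_⟩
    by_contra! hlt
    obtain ⟨y, hy, hly, hneg⟩ := hl'
    refine hneg.not_ge (hw.reflDiff_nonneg_of_small le_rfl hεa ?_ ?_ hy hly)
    · exact fun y hy h => hS (y.1, 2 * l' - y.2) hy (by simp only; linarith)
    · exact fun y _ h => (reflDiff_of_eq w h).ge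
  set s := sInf bad with hs
  have hgood : ∀ y : EuclideanSpace ℝ (Fin n) × ℝ, y.1 ≠ 0 → s ≤ y.2 → 0 ≤ reflDiff w s y := by
    intro y hy hsy
    have hc : ContinuousAt (fun l' => reflDiff w l' y) s := by
      refine ContinuousAt.sub continuousAt_const ?_
      exact ContinuousAt.comp (f := fun l' : ℝ => (y.1, 2 * l' - y.2)) (g := w)
        (hw.contDiffAt (x := (y.1, 2 * s - y.2)) hy).continuousAt (by fun_prop)
    refine ge_of_tendsto (hc.tendsto.mono_left (nhdsWithin_le_nhds (s := Set.Iio s))) ?_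
    filter_upwards [self_mem_nhdsWithin] with l' hl'
    by_contra! hneg
    exact (notMem_of_lt_csInf hl' hbdd) ⟨y, hy, (le_of_lt hl').trans hsy, hneg⟩
  obtain ⟨δ, hδ, hδn⟩ := hw.eventually_reflDiff_nonneg fun y hy hsy => hw.reflDiff_pos hn hgood hy hsy
  obtain ⟨l', hl', hl's⟩ := exists_lt_of_csInf_lt hne (lt_add_of_pos_right s hδ)
  obtain ⟨y, hy, hly, hneg⟩ := hl'
  rcases (csInf_le hbdd ⟨y, hy, hly, hneg⟩ : s ≤ l').eq_or_lt with h | h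
  · rw [← h] at hneg hly
    exact hneg.not_ge (hgood y hy hly)
  · exact hneg.not_ge (hδn l' h hl's y hy hly)

/-- A solution is monotone along the axis of the cylinder. -/
theorem monotone (hw : IsCylinderSolution w k a p M) (hn : 2 ≤ n)
    {y : EuclideanSpace ℝ (Fin n)} (hy : y ≠ 0) : Monotone fun t => w (y, t) := by
  intro s t hst
  have := hw.reflDiff_nonneg hn ((s + t) / 2) (x := (y, t)) hy (by simp only; linarith)
  have e : 2 * ((s + t) / 2) - t = s := by ring
  simp only [reflDiff, e] at this
  simp only
  linarith

end IsCylinderSolution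

end MovingPlanes

section Embedding

variable {n : ℕ}

theorem hasDerivAt_norm_comp {F : Type*} [NormedAddCommGroup F] [InnerProductSpace ℝ F]
    {z : ℝ → F} {z' : F} {r : ℝ} (h : HasDerivAt z z' r) (h0 : z r ≠ 0) :
    HasDerivAt (fun r => ‖z r‖) (inner ℝ (z r) z' / ‖z r‖) r := by
  have h1 := h.norm_sq.sqrt (by positivity)
  simp only [Real.sqrt_sq (norm_nonneg _)] at h1
  convert h1 using 1
  field_simp

/-- The linear identification of `ℝⁿ × ℝ` with `ℝⁿ⁺¹`. -/
noncomputable def appendLast (n : ℕ) :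
    (EuclideanSpace ℝ (Fin n) × ℝ) →L[ℝ] EuclideanSpace ℝ (Fin (n + 1)) :=
  LinearMap.toContinuousLinearMap
    { toFun := fun q => WithLp.toLp 2 (Fin.snoc (α := fun _ => ℝ) q.1.ofLp q.2)
      map_add' := fun p q => by
        ext i
        refine Fin.lastCases ?_ (fun j => ?_) i <;> simp
      map_smul' := fun c q => by
        ext i
        refine Fin.lastCases ?_ (fun j => ?_) i <;> simp }

@[simp]
theorem appendLast_castSucc (q : EuclideanSpace ℝ (Fin n) × ℝ) (i : Fin n) :
    appendLast n q i.castSucc = q.1 i := by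
  simp [appendLast]

@[simp]
theorem appendLast_last (q : EuclideanSpace ℝ (Fin n) × ℝ) :
    appendLast n q (Fin.last n) = q.2 := by
  simp [appendLast]

theorem norm_appendLast_sq (q : EuclideanSpace ℝ (Fin n) × ℝ) :
    ‖appendLast n q‖ ^ 2 = ‖q.1‖ ^ 2 + q.2 ^ 2 := by
  simp [EuclideanSpace.norm_sq_eq, Fin.sum_univ_castSucc]

theorem appendLast_single (i : Fin n) :
    appendLast n (EuclideanSpace.single i 1, 0) = EuclideanSpace.single i.castSucc 1 := by
  ext j
  refine Fin.lastCases ?_ (fun j => ?_) j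
  · simp
  · simp

theorem appendLast_zero_one : appendLast n (0, 1) = EuclideanSpace.single (Fin.last n) 1 := by
  ext j
  refine Fin.lastCases ?_ (fun j => ?_) j
  · simp
  · simp

theorem appendLast_eq_sum (y : EuclideanSpace ℝ (Fin n)) (s : ℝ) :
    appendLast n (y, s) = ∑ i, y i • EuclideanSpace.single i.castSucc (1 : ℝ)
      + s • EuclideanSpace.single (Fin.last n) 1 := by
  ext j
  refine Fin.lastCases ?_ (fun j => ?_) j
  · simp
  · simp [Pi.single_apply]

/-- The conformal parametrisation of the punctured sphere by the cylinder, up to positive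
scalings. -/
noncomputable def cylMap (n : ℕ) (q : EuclideanSpace ℝ (Fin n) × ℝ) :
    EuclideanSpace ℝ (Fin (n + 1)) :=
  appendLast n (q.1, ‖q.1‖ * Real.sinh q.2)

theorem norm_cylMap (q : EuclideanSpace ℝ (Fin n) × ℝ) :
    ‖cylMap n q‖ = ‖q.1‖ * Real.cosh q.2 := by
  rw [← sq_eq_sq₀ (norm_nonneg _) (mul_nonneg (norm_nonneg _) (Real.cosh_pos _).le), cylMap,
    norm_appendLast_sq, mul_pow, mul_pow, Real.cosh_sq]
  ring

theorem cylMap_ne_zero {q : EuclideanSpace ℝ (Fin n) × ℝ} (hq : q.1 ≠ 0) : cylMap n q ≠ 0 := by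
  rw [← norm_pos_iff, norm_cylMap]
  exact mul_pos (norm_pos_iff.2 hq) (Real.cosh_pos _)

theorem cylMap_smul {c : ℝ} (hc : 0 < c) (q : EuclideanSpace ℝ (Fin n) × ℝ) :
    cylMap n (c • q.1, q.2) = c • cylMap n q := by
  simp only [cylMap, ← map_smul, Prod.smul_mk, norm_smul, Real.norm_of_nonneg hc.le, smul_eq_mul,
    mul_assoc]

theorem contDiffAt_cylMap {q : EuclideanSpace ℝ (Fin n) × ℝ} (hq : q.1 ≠ 0) :
    ContDiffAt ℝ 2 (cylMap n) q := by
  have h1 : ContDiffAt ℝ 2 (fun q : EuclideanSpace ℝ (Fin n) × ℝ => ‖q.1‖) q :=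
    contDiffAt_fst.norm ℝ hq
  have h2 : ContDiffAt ℝ 2 (fun q : EuclideanSpace ℝ (Fin n) × ℝ => Real.sinh q.2) q :=
    contDiffAt_snd.sinh
  exact (appendLast n).contDiff.contDiffAt.comp q (contDiffAt_fst.prodMk (h1.mul h2))

theorem hasDerivAt_cylMap_snd (y : EuclideanSpace ℝ (Fin n)) (t : ℝ) :
    HasDerivAt (fun r => cylMap n (y, r))
      ((‖y‖ * Real.cosh t) • EuclideanSpace.single (Fin.last n) 1) t := by
  have := (appendLast n).hasFDerivAt.comp_hasDerivAt t
    ((hasDerivAt_const t y).prodMk ((Real.hasDerivAt_sinh t).const_mul ‖y‖))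
  rw [← appendLast_zero_one, ← map_smul]
  simpa [Function.comp_def, cylMap] using this

theorem fderiv_apply_self_of_hom {F : Type*} [NormedAddCommGroup F] [NormedSpace ℝ F] {V : F → ℝ}
    {x : F} (hV : DifferentiableAt ℝ V x) (hom : ∀ c : ℝ, 0 < c → ∀ x, V (c • x) = V x) :
    fderiv ℝ V x x = 0 := by
  have h1 : HasDerivAt (fun c : ℝ => c • x) x 1 := by
    simpa using (hasDerivAt_id (1 : ℝ)).smul_const x
  have h2 : HasDerivAt (fun c : ℝ => V (c • x)) (fderiv ℝ V x x) 1 :=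
    HasFDerivAt.comp_hasDerivAt (f := fun c : ℝ => c • x) (1 : ℝ)
      (by simpa using hV.hasFDerivAt) h1
  have h3 : (fun c : ℝ => V (c • x)) =ᶠ[𝓝 1] fun _ => V x := by
    filter_upwards [lt_mem_nhds one_pos] with c hc using hom c hc x
  exact h2.unique ((hasDerivAt_const (1 : ℝ) (V x)).congr_of_eventuallyEq h3)

theorem fderiv_fderiv_apply_self_of_hom {F : Type*} [NormedAddCommGroup F] [NormedSpace ℝ F]
    {V : F → ℝ} {x : F} (hV : ContDiffAt ℝ 2 V x)
    (hom : ∀ c : ℝ, 0 < c → ∀ x, V (c • x) = V x) (d : F) :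
    fderiv ℝ (fderiv ℝ V) x d x = - fderiv ℝ V x d := by
  have h2 : HasFDerivAt (fderiv ℝ V) (fderiv ℝ (fderiv ℝ V) x) x :=
    ((hV.fderiv_right (m := 1) (by norm_num)).differentiableAt (by simp)).hasFDerivAt
  have h3 := h2.clm_apply (hasFDerivAt_id x)
  have h4 : (fun y => fderiv ℝ V y (id y)) =ᶠ[𝓝 x] fun _ => (0 : ℝ) := by
    filter_upwards [hV.eventually (by simp)] with y hy
    exact fderiv_apply_self_of_hom (hy.differentiableAt (by simp)) hom
  have h5 := h3.unique ((hasFDerivAt_const (0 : ℝ) x).congr_of_eventuallyEq h4)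
  have h6 := DFunLike.congr_fun h5 d
  simp at h6
  linarith

theorem secondDirDeriv_cyl_fst {V : EuclideanSpace ℝ (Fin (n + 1)) → ℝ} (g : ℝ → ℝ)
    {y : EuclideanSpace ℝ (Fin n)} (hy : y ≠ 0) {t : ℝ} (hV : ContDiffAt ℝ 2 V (cylMap n (y, t)))
    (i : Fin n) :
    secondDirDeriv (fun q => g q.2 * V (cylMap n q)) (y, t) (EuclideanSpace.single i 1, 0)
      = g t * (fderiv ℝ (fderiv ℝ V) (cylMap n (y, t))
          (appendLast n (EuclideanSpace.single i 1, y i / ‖y‖ * Real.sinh t))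
          (appendLast n (EuclideanSpace.single i 1, y i / ‖y‖ * Real.sinh t))
        + fderiv ℝ V (cylMap n (y, t))
          (appendLast n (0, (1 / ‖y‖ - y i ^ 2 / ‖y‖ ^ 3) * Real.sinh t))) := by
  set e : EuclideanSpace ℝ (Fin n) := EuclideanSpace.single i 1 with he
  have hline : ∀ r : ℝ, HasDerivAt (fun r : ℝ => y + r • e) e r := fun r => by
    simpa using ((hasDerivAt_id r).smul_const e).const_add y
  have hne : ∀ᶠ r : ℝ in 𝓝 0, y + r • e ≠ 0 := by
    have : ContinuousAt (fun r : ℝ => y + r • e) 0 := (hline 0).continuousAt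
    exact this.eventually_ne (by simpa using hy)
  have hin : ∀ r : ℝ, inner ℝ (y + r • e) e = y i + r := fun r => by
    simp [he, inner_add_left, inner_smul_left, EuclideanSpace.inner_single_right]
  have hnorm : ∀ r : ℝ, y + r • e ≠ 0 →
      HasDerivAt (fun r : ℝ => ‖y + r • e‖) ((y i + r) / ‖y + r • e‖) r := fun r hr => by
    rw [← hin]; exact hasDerivAt_norm_comp (hline r) hr
  have hγ : ∀ᶠ r : ℝ in 𝓝 0, HasDerivAt (fun r : ℝ => cylMap n (y + r • e, t))
      (appendLast n (e, (y i + r) / ‖y + r • e‖ * Real.sinh t)) r := by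
    filter_upwards [hne] with r hr
    exact (appendLast n).hasFDerivAt.comp_hasDerivAt r
      ((hline r).prodMk ((hnorm r hr).mul_const (Real.sinh t)))
  have hy' : ‖y‖ ≠ 0 := norm_ne_zero_iff.2 hy
  have hγ' : HasDerivAt (fun r : ℝ => appendLast n (e, (y i + r) / ‖y + r • e‖ * Real.sinh t))
      (appendLast n (0, (1 / ‖y‖ - y i ^ 2 / ‖y‖ ^ 3) * Real.sinh t)) 0 := by
    refine (appendLast n).hasFDerivAt.comp_hasDerivAt (0 : ℝ)
      ((hasDerivAt_const (0 : ℝ) e).prodMk ?_)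
    have h := (((hasDerivAt_id (0 : ℝ)).const_add (y i)).fun_div (hnorm 0 hne.self_of_nhds)
      (by simpa using hy)).mul_const (Real.sinh t)
    refine h.congr_deriv ?_
    simp only [zero_smul, add_zero, id]
    field_simp
  have hV' : ContDiffAt ℝ 2 V (cylMap n (y + (0 : ℝ) • e, t)) := by simpa using hV
  have H := hasDerivAt_comp_curve (G := V) (γ := fun r : ℝ => cylMap n (y + r • e, t)) hV' hγ hγ'
  have := iteratedDeriv_two_of_hasDerivAt (H.1.mono fun r hr => hr.const_mul (g t))
    (H.2.const_mul (g t))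
  simpa [secondDirDeriv] using this

theorem secondDirDeriv_cyl_snd {V : EuclideanSpace ℝ (Fin (n + 1)) → ℝ} {g g' : ℝ → ℝ} {g'' : ℝ}
    {y : EuclideanSpace ℝ (Fin n)} {t : ℝ} (hV : ContDiffAt ℝ 2 V (cylMap n (y, t)))
    (hg : ∀ r, HasDerivAt g (g' r) r) (hg' : HasDerivAt g' g'' t) :
    secondDirDeriv (fun q => g q.2 * V (cylMap n q)) (y, t) (0, 1)
      = g'' * V (cylMap n (y, t))
        + 2 * g' t * (‖y‖ * Real.cosh t) * fderiv ℝ V (cylMap n (y, t))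
            (EuclideanSpace.single (Fin.last n) 1)
        + g t * ((‖y‖ * Real.cosh t) ^ 2 * fderiv ℝ (fderiv ℝ V) (cylMap n (y, t))
            (EuclideanSpace.single (Fin.last n) 1) (EuclideanSpace.single (Fin.last n) 1)
          + ‖y‖ * Real.sinh t * fderiv ℝ V (cylMap n (y, t))
            (EuclideanSpace.single (Fin.last n) 1)) := by
  set e : EuclideanSpace ℝ (Fin (n + 1)) := EuclideanSpace.single (Fin.last n) 1
  have hγ' : HasDerivAt (fun r : ℝ => (‖y‖ * Real.cosh r) • e) ((‖y‖ * Real.sinh t) • e) t :=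
    ((Real.hasDerivAt_cosh t).const_mul ‖y‖).smul_const e
  have H := hasDerivAt_comp_curve (G := V) (γ := fun r : ℝ => cylMap n (y, r)) hV
    (Eventually.of_forall fun r => hasDerivAt_cylMap_snd y r) hγ'
  have h1 := iteratedDeriv_two_of_hasDerivAt
    (H.1.mono fun r hr => (hg r).fun_mul hr)
    ((hg'.fun_mul H.1.self_of_nhds).fun_add ((hg t).fun_mul H.2))
  have h2 : secondDirDeriv (fun q => g q.2 * V (cylMap n q)) (y, t) (0, 1)
      = iteratedDeriv 2 (fun r => g r * V (cylMap n (y, r))) t := by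
    have := iteratedDeriv_comp_const_add 2 (fun r => g r * V (cylMap n (y, r))) t
    have := congrFun this 0
    simpa [secondDirDeriv] using this
  rw [h2, h1]
  simp only [map_smul, smul_apply, smul_eq_mul]
  ring

end Embedding

section CylinderEquation

variable {n : ℕ}

theorem eLaplacian_eq_sum_fderiv {m : ℕ} (u : EuclideanSpace ℝ (Fin m) → ℝ)
    (x : EuclideanSpace ℝ (Fin m)) :
    eLaplacian u x = ∑ i, fderiv ℝ (fderiv ℝ u) x (EuclideanSpace.single i 1)
      (EuclideanSpace.single i 1) := by
  simp [eLaplacian, iteratedFDeriv_two_apply]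

theorem eLaplacian_eq_mul_of_hom {m : ℕ} {V : EuclideanSpace ℝ (Fin m) → ℝ}
    {x : EuclideanSpace ℝ (Fin m)} {c : ℝ} (hc : 0 < c) (hV : ContDiffAt ℝ 2 V x)
    (hV' : ContDiffAt ℝ 2 V (c • x)) (hom : ∀ c : ℝ, 0 < c → ∀ x, V (c • x) = V x) :
    eLaplacian V x = c ^ 2 * eLaplacian V (c • x) := by
  simp only [eLaplacian_eq_sum_fderiv, ← secondDirDeriv_eq_fderiv hV,
    ← secondDirDeriv_eq_fderiv hV', ← secondDirDeriv_smul hV', Finset.mul_sum]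
  refine Finset.sum_congr rfl fun i _ => ?_
  unfold secondDirDeriv
  congr 1
  ext s
  rw [← hom c hc, smul_add, smul_comm c s]

theorem appendLast_single_add (i : Fin n) (c : ℝ) :
    appendLast n (EuclideanSpace.single i 1, c)
      = EuclideanSpace.single i.castSucc 1 + c • EuclideanSpace.single (Fin.last n) 1 := by
  rw [← appendLast_single, ← appendLast_zero_one, ← map_smul, ← map_add]
  simp

theorem hasDerivAt_cosh_rpow (b t : ℝ) :
    HasDerivAt (fun r => Real.cosh r ^ b) (b * Real.cosh t ^ (b - 1) * Real.sinh t) t := by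
  convert (Real.hasDerivAt_cosh t).rpow_const (p := b) (Or.inl (Real.cosh_pos t).ne') using 1
  ring

theorem cylLaplacian_cyl {V : EuclideanSpace ℝ (Fin (n + 1)) → ℝ} {a : ℝ} (ha : 2 * a = n - 2)
    {y : EuclideanSpace ℝ (Fin n)} (hy : y ≠ 0) {t : ℝ}
    (hV : ContDiffAt ℝ 2 V (cylMap n (y, t)))
    (hom : ∀ c : ℝ, 0 < c → ∀ x, V (c • x) = V x) :
    cylLaplacian (fun q => Real.cosh q.2 ^ (-a) * V (cylMap n q)) (y, t)
      = Real.cosh t ^ (-a) * (‖y‖ ^ 2 * eLaplacian V (cylMap n (y, t))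
        + (a ^ 2 - (a ^ 2 + a) / Real.cosh t ^ 2) * V (cylMap n (y, t))) := by
  have hg' : HasDerivAt (fun t => -a * Real.cosh t ^ (-a - 1) * Real.sinh t)
      (-a * ((-a - 1) * Real.cosh t ^ (-a - 1 - 1) * Real.sinh t) * Real.sinh t
        + -a * Real.cosh t ^ (-a - 1) * Real.cosh t) t :=
    ((hasDerivAt_cosh_rpow (-a - 1) t).const_mul (-a)).fun_mul (Real.hasDerivAt_sinh t)
  have hcosh := Real.cosh_pos t
  have hr : ‖y‖ ≠ 0 := norm_ne_zero_iff.2 hy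
  have hsum : ∑ i, y i ^ 2 = ‖y‖ ^ 2 := by simp [EuclideanSpace.norm_sq_eq]
  have hsymm := (hV.isSymmSndFDerivAt (by simp)).eq
  have hBX := fderiv_fderiv_apply_self_of_hom hV hom (EuclideanSpace.single (Fin.last n) 1)
  rw [cylLaplacian, secondDirDeriv_cyl_snd hV (hasDerivAt_cosh_rpow (-a)) hg']
  simp only [secondDirDeriv_cyl_fst (fun t => Real.cosh t ^ (-a)) hy hV]
  rw [eLaplacian_eq_sum_fderiv, Fin.sum_univ_castSucc]
  conv_lhs at hBX => arg 2; rw [cylMap, appendLast_eq_sum]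
  have h0 : ∀ s : ℝ, appendLast n (0, s) = s • EuclideanSpace.single (Fin.last n) 1 := fun s => by
    rw [← appendLast_zero_one, ← map_smul]; simp
  simp only [appendLast_single_add, h0]
  generalize fderiv ℝ (fderiv ℝ V) (cylMap n (y, t)) = B at *
  generalize fderiv ℝ V (cylMap n (y, t)) = L at *
  generalize V (cylMap n (y, t)) = v₀ at *
  generalize (EuclideanSpace.single (Fin.last n) 1 : EuclideanSpace ℝ (Fin (n + 1))) = e at *
  simp only [map_add, map_sum, map_smul, smul_eq_mul, add_apply, smul_apply] at hBX ⊢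
  have hs : ∀ i : Fin n, B (EuclideanSpace.single i.castSucc 1) e
      = B e (EuclideanSpace.single i.castSucc 1) := fun i => hsymm _ _
  simp only [hs]
  generalize hD : (fun i : Fin n => B e (EuclideanSpace.single i.castSucc 1)) = D at *
  have hD' : ∀ i : Fin n, B e (EuclideanSpace.single i.castSucc 1) = D i := congrFun hD
  simp only [hD'] at hBX ⊢
  generalize hA : (fun i : Fin n => B (EuclideanSpace.single i.castSucc 1)
    (EuclideanSpace.single i.castSucc 1)) = A
  have hA' : ∀ i : Fin n, B (EuclideanSpace.single i.castSucc 1)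
    (EuclideanSpace.single i.castSucc 1) = A i := congrFun hA
  simp only [hA']
  generalize B e e = b at *
  generalize L e = ℓ at *
  have key : ∑ i : Fin n, Real.cosh t ^ (-a) * (A i + y i / ‖y‖ * Real.sinh t * D i
        + y i / ‖y‖ * Real.sinh t * (D i + y i / ‖y‖ * Real.sinh t * b)
        + (1 / ‖y‖ - y i ^ 2 / ‖y‖ ^ 3) * Real.sinh t * ℓ)
      = Real.cosh t ^ (-a) * (∑ i, A i + 2 * Real.sinh t / ‖y‖ * ∑ i, y i * D i
        + Real.sinh t ^ 2 * b + (n - 1) / ‖y‖ * Real.sinh t * ℓ) := by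
    have h1 : Real.sinh t ^ 2 * b = Real.sinh t ^ 2 * b / ‖y‖ ^ 2 * ∑ i, y i ^ 2 := by
      rw [hsum]; field_simp
    have h2 : (n - 1) / ‖y‖ * Real.sinh t * ℓ = ∑ i : Fin n, Real.sinh t * ℓ / ‖y‖
        - Real.sinh t * ℓ / ‖y‖ ^ 3 * ∑ i, y i ^ 2 := by
      rw [hsum, Finset.sum_const, Finset.card_univ, Fintype.card_fin, nsmul_eq_mul]
      field_simp
    rw [h1, h2, Finset.mul_sum, Finset.mul_sum, Finset.mul_sum, ← Finset.sum_add_distrib,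
      ← Finset.sum_add_distrib, ← Finset.sum_sub_distrib, ← Finset.sum_add_distrib,
      Finset.mul_sum]
    refine Finset.sum_congr rfl fun i _ => ?_
    ring
  have hBX' : ∑ i, y i * D i = -ℓ - ‖y‖ * Real.sinh t * b := by linarith
  have hp1 : Real.cosh t ^ (-a - 1) = Real.cosh t ^ (-a) / Real.cosh t := by
    rw [Real.rpow_sub_one hcosh.ne']
  have hp2 : Real.cosh t ^ (-a - 1 - 1) = Real.cosh t ^ (-a) / Real.cosh t ^ 2 := by
    rw [Real.rpow_sub_one hcosh.ne', hp1]; field_simp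
  have hn : (n : ℝ) = 2 * a + 2 := by linarith
  rw [key, hBX', hp1, hp2, hn]
  have hsq : Real.sinh t ^ 2 = Real.cosh t ^ 2 - 1 := Real.sinh_sq t
  field_simp
  ring_nf
  simp only [hsq]
  ring

end CylinderEquation

section Sphere

variable {n : ℕ}

/-- The degree-zero homogeneous extension of a function on the unit sphere. -/
noncomputable def sphExt {m : ℕ} (v : EuclideanSpace ℝ (Fin m) → ℝ)
    (x : EuclideanSpace ℝ (Fin m)) : ℝ :=
  v (‖x‖⁻¹ • x)

theorem inv_norm_smul_smul {F : Type*} [NormedAddCommGroup F] [NormedSpace ℝ F] {c : ℝ}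
    (hc : 0 < c) (x : F) : ‖c • x‖⁻¹ • c • x = ‖x‖⁻¹ • x := by
  rw [norm_smul, Real.norm_of_nonneg hc.le, smul_smul, mul_inv, mul_comm c⁻¹, mul_assoc,
    inv_mul_cancel₀ hc.ne', mul_one]

theorem sphExt_smul {m : ℕ} (v : EuclideanSpace ℝ (Fin m) → ℝ) (c : ℝ) (hc : 0 < c)
    (x : EuclideanSpace ℝ (Fin m)) : sphExt v (c • x) = sphExt v x := by
  rw [sphExt, sphExt, inv_norm_smul_smul hc]

theorem sphExt_of_norm_eq_one {m : ℕ} (v : EuclideanSpace ℝ (Fin m) → ℝ)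
    {θ : EuclideanSpace ℝ (Fin m)} (hθ : ‖θ‖ = 1) : sphExt v θ = v θ := by
  simp [sphExt, hθ]

theorem norm_inv_norm_smul {F : Type*} [NormedAddCommGroup F] [NormedSpace ℝ F] {x : F}
    (hx : x ≠ 0) : ‖‖x‖⁻¹ • x‖ = 1 := by
  simp [norm_smul, hx]

theorem fderiv_inv_norm_smul_of_hom {F : Type*} [NormedAddCommGroup F] [NormedSpace ℝ F] {V : F → ℝ}
    (hom : ∀ c : ℝ, 0 < c → ∀ x, V (c • x) = V x) {x : F} (hx : x ≠ 0) (d : F) :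
    ‖x‖ * fderiv ℝ V x d = fderiv ℝ V (‖x‖⁻¹ • x) d := by
  have hp : 0 < ‖x‖ := norm_pos_iff.2 hx
  have h := fderiv_comp_smul (𝕜 := ℝ) (f := V) (x := x) ‖x‖⁻¹
  have h2 : (fun y => V (‖x‖⁻¹ • y)) = V := funext fun y => hom _ (inv_pos.2 hp) y
  rw [h2] at h
  rw [h]
  simp [hp.ne']

theorem isOpen_inv_norm_smul_ne {F : Type*} [NormedAddCommGroup F] [NormedSpace ℝ F] (e : F) :
    IsOpen {x : F | x ≠ 0 ∧ ‖x‖⁻¹ • x ≠ e} := by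
  rw [isOpen_iff_mem_nhds]
  rintro x ⟨hx, hxe⟩
  have hc : ContinuousAt (fun x : F => ‖x‖⁻¹ • x) x :=
    (continuousAt_id.norm.inv₀ (norm_ne_zero_iff.2 hx)).smul continuousAt_id
  exact (eventually_ne_nhds hx).and (hc.eventually_ne hxe)

theorem inv_norm_smul_cylMap_ne {q : EuclideanSpace ℝ (Fin n) × ℝ} (hq : q.1 ≠ 0) :
    ‖cylMap n q‖⁻¹ • cylMap n q ≠ EuclideanSpace.single (Fin.last n) 1 := by
  intro h
  refine hq (PiLp.ext fun i => ?_)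
  have := congrArg (fun x : EuclideanSpace ℝ (Fin (n + 1)) => x i.castSucc) h
  have h0 : ‖cylMap n q‖⁻¹ * q.1 i = 0 := by simpa [cylMap] using this
  exact (mul_eq_zero.1 h0).resolve_left (inv_ne_zero (norm_ne_zero_iff.2 (cylMap_ne_zero hq)))

theorem exists_cylMap_eq {θ : EuclideanSpace ℝ (Fin (n + 1))} (hθ : ‖θ‖ = 1)
    (h1 : θ ≠ EuclideanSpace.single (Fin.last n) 1)
    (h2 : θ ≠ -EuclideanSpace.single (Fin.last n) 1) : ∃ y t, y ≠ 0 ∧ cylMap n (y, t) = θ := by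
  let y : EuclideanSpace ℝ (Fin n) := WithLp.toLp 2 fun i => θ i.castSucc
  have hyθ : appendLast n (y, θ (Fin.last n)) = θ := by
    ext i
    refine Fin.lastCases ?_ (fun j => ?_) i <;> simp [y]
  have hy : y ≠ 0 := by
    intro hy
    have h3 : θ = θ (Fin.last n) • EuclideanSpace.single (Fin.last n) (1 : ℝ) := by
      conv_lhs => rw [← hyθ, hy]
      rw [← appendLast_zero_one, ← map_smul]
      simp
    have h4 : |θ (Fin.last n)| = 1 := by
      rw [h3] at hθ
      simpa [norm_smul] using hθ
    rcases eq_or_eq_neg_of_abs_eq h4 with h5 | h5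
    · exact h1 (by rw [h3, h5, one_smul])
    · exact h2 (by rw [h3, h5, neg_one_smul])
  refine ⟨y, Real.arsinh (θ (Fin.last n) / ‖y‖), hy, ?_⟩
  rw [cylMap, Real.sinh_arsinh, mul_div_cancel₀ _ (norm_ne_zero_iff.2 hy), hyθ]

theorem hasDerivAt_sphExt_cylMap {K : EuclideanSpace ℝ (Fin (n + 1)) → ℝ}
    (hK : ContDiffOn ℝ 1 (sphExt K) {x | x ≠ 0}) {y : EuclideanSpace ℝ (Fin n)} (hy : y ≠ 0)
    (t : ℝ) :
    HasDerivAt (fun r => sphExt K (cylMap n (y, r)))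
      (fderiv ℝ (sphExt K) (‖cylMap n (y, t)‖⁻¹ • cylMap n (y, t))
        (EuclideanSpace.single (Fin.last n) 1)) t := by
  have hX : cylMap n (y, t) ≠ 0 := cylMap_ne_zero hy
  have hd : DifferentiableAt ℝ (sphExt K) (cylMap n (y, t)) :=
    (hK.contDiffAt (isOpen_ne.mem_nhds hX)).differentiableAt (by simp)
  have := hd.hasFDerivAt.comp_hasDerivAt t (hasDerivAt_cylMap_snd y t)
  rw [← fderiv_inv_norm_smul_of_hom (sphExt_smul K) hX, norm_cylMap]
  simpa [Function.comp_def] using this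

theorem isCompact_lower_hemisphere :
    IsCompact {θ : EuclideanSpace ℝ (Fin (n + 1)) | ‖θ‖ = 1 ∧ θ (Fin.last n) ≤ 0} := by
  have h1 : {θ : EuclideanSpace ℝ (Fin (n + 1)) | ‖θ‖ = 1 ∧ θ (Fin.last n) ≤ 0}
      = Metric.sphere 0 1 ∩ {θ | θ (Fin.last n) ≤ 0} := by
    ext; simp
  rw [h1]
  exact (isCompact_sphere 0 1).inter_right (isClosed_le (by fun_prop) continuous_const)

variable {K v : EuclideanSpace ℝ (Fin (n + 1)) → ℝ}

theorem exists_abs_le_of_continuousOn_sphExt (hK : ContinuousOn (sphExt K) {x | x ≠ 0}) :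
    ∃ M, 0 < M ∧ ∀ θ, ‖θ‖ = 1 → |K θ| ≤ M := by
  obtain ⟨M, hM⟩ := (isCompact_sphere (0 : EuclideanSpace ℝ (Fin (n + 1))) 1).exists_bound_of_continuousOn
    (hK.mono fun θ hθ => Metric.ne_of_mem_sphere hθ one_ne_zero)
  refine ⟨max M 1, by positivity, fun θ hθ => ?_⟩
  have := hM θ (by simpa using hθ)
  rw [sphExt_of_norm_eq_one K hθ] at this
  exact this.trans (le_max_left _ _)

theorem exists_bounds_lower_hemisphere
    (hv : ContDiffOn ℝ 2 (sphExt v)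
      {x | x ≠ 0 ∧ ‖x‖⁻¹ • x ≠ EuclideanSpace.single (Fin.last n) 1})
    (hpos : ∀ θ, ‖θ‖ = 1 → θ ≠ EuclideanSpace.single (Fin.last n) 1 → 0 < v θ) :
    ∃ c B : ℝ, 0 < c ∧ 0 < B ∧ ∀ θ, ‖θ‖ = 1 → θ (Fin.last n) ≤ 0 → c ≤ v θ ∧ v θ ≤ B := by
  have hne : ∀ θ : EuclideanSpace ℝ (Fin (n + 1)), θ (Fin.last n) ≤ 0 →
      θ ≠ EuclideanSpace.single (Fin.last n) 1 := by
    rintro _ h rfl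
    norm_num at h
  have hc : ContinuousOn (sphExt v)
      {θ : EuclideanSpace ℝ (Fin (n + 1)) | ‖θ‖ = 1 ∧ θ (Fin.last n) ≤ 0} :=
    hv.continuousOn.mono fun θ ⟨h1, h2⟩ =>
      ⟨norm_ne_zero_iff.1 (by simp [h1]), by simpa [h1] using hne θ h2⟩
  have hs : ({θ : EuclideanSpace ℝ (Fin (n + 1)) | ‖θ‖ = 1 ∧ θ (Fin.last n) ≤ 0}).Nonempty :=
    ⟨-EuclideanSpace.single (Fin.last n) 1, by simp, by simp⟩
  obtain ⟨θ₁, h₁, hmin⟩ := isCompact_lower_hemisphere.exists_isMinOn hs hc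
  obtain ⟨θ₂, h₂, hmax⟩ := isCompact_lower_hemisphere.exists_isMaxOn hs hc
  refine ⟨v θ₁, v θ₂, hpos _ h₁.1 (hne _ h₁.2), hpos _ h₂.1 (hne _ h₂.2), fun θ h h' => ?_⟩
  have h3 := hmin (a := θ) ⟨h, h'⟩
  have h4 := hmax (a := θ) ⟨h, h'⟩
  simp only [Set.mem_ofPred_eq, sphExt_of_norm_eq_one v h, sphExt_of_norm_eq_one v h₁.1,
    sphExt_of_norm_eq_one v h₂.1] at h3 h4
  exact ⟨h3, h4⟩

theorem lt_of_hasDerivAt_ne_zero {k k' : ℝ → ℝ} (hk : ∀ t, HasDerivAt k (k' t) t)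
    (hmono : Monotone k) {s t₀ t : ℝ} (hs : s < t₀) (ht : t₀ < t) (h0 : k' t₀ ≠ 0) :
    k s < k t := by
  by_contra! h
  refine h0 ((hk t₀).unique ((hasDerivAt_const t₀ (k s)).congr_of_eventuallyEq ?_))
  filter_upwards [Ioo_mem_nhds hs ht] with r hr
  exact le_antisymm ((hmono hr.2.le).trans h) (hmono hr.1.le)

theorem exists_isCylinderSolution (hn : 3 ≤ n)
    (hK : ContDiffOn ℝ 1 (sphExt K) {x | x ≠ 0})
    (hK_mono : ∀ θ, ‖θ‖ = 1 → 0 ≤ fderiv ℝ (sphExt K) θ (EuclideanSpace.single (Fin.last n) 1))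
    (hK_ne : ∃ θ, ‖θ‖ = 1 ∧ θ ≠ EuclideanSpace.single (Fin.last n) 1 ∧
      θ ≠ -EuclideanSpace.single (Fin.last n) 1 ∧
      fderiv ℝ (sphExt K) θ (EuclideanSpace.single (Fin.last n) 1) ≠ 0)
    (hv : ContDiffOn ℝ 2 (sphExt v)
      {x | x ≠ 0 ∧ ‖x‖⁻¹ • x ≠ EuclideanSpace.single (Fin.last n) 1})
    (hpos : ∀ θ, ‖θ‖ = 1 → θ ≠ EuclideanSpace.single (Fin.last n) 1 → 0 < v θ)
    (heq : ∀ θ, ‖θ‖ = 1 → θ ≠ EuclideanSpace.single (Fin.last n) 1 →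
      -(sphLaplacian v θ - ((n : ℝ) * ((n : ℝ) - 2) / 4) * v θ)
        = K θ * v θ ^ (((n : ℝ) + 2) / ((n : ℝ) - 2))) :
    ∃ M, IsCylinderSolution
      (fun q => Real.cosh q.2 ^ (-(((n : ℝ) - 2) / 2)) * sphExt v (cylMap n q))
      (fun q => sphExt K (cylMap n q)) (((n : ℝ) - 2) / 2) (((n : ℝ) + 2) / ((n : ℝ) - 2)) M := by
  have hn' : (3 : ℝ) ≤ n := by exact_mod_cast hn
  obtain ⟨M, hM, hKM⟩ := exists_abs_le_of_continuousOn_sphExt hK.continuousOn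
  have hXn : ∀ {q : EuclideanSpace ℝ (Fin n) × ℝ}, q.1 ≠ 0 →
      ‖‖cylMap n q‖⁻¹ • cylMap n q‖ = 1 := fun hq => norm_inv_norm_smul (cylMap_ne_zero hq)
  have hvX : ∀ {x : EuclideanSpace ℝ (Fin (n + 1))}, x ≠ 0 →
      ‖x‖⁻¹ • x ≠ EuclideanSpace.single (Fin.last n) 1 → ContDiffAt ℝ 2 (sphExt v) x :=
    fun h1 h2 => hv.contDiffAt ((isOpen_inv_norm_smul_ne _).mem_nhds ⟨h1, h2⟩)
  have hmono : ∀ y : EuclideanSpace ℝ (Fin n), y ≠ 0 →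
      Monotone fun t => sphExt K (cylMap n (y, t)) := fun y hy =>
    monotone_of_hasDerivAt_nonneg (hasDerivAt_sphExt_cylMap hK hy) fun t => hK_mono _ (hXn hy)
  refine ⟨M, ?_, ?_, ?_, ?_, by linarith, ?_, hM, fun q hq => hKM _ (hXn hq),
    fun y hy s t hst => hmono y hy hst, ?_, ?_⟩
  · intro q hq
    have h1 : ContDiffAt ℝ 2 (fun q : EuclideanSpace ℝ (Fin n) × ℝ =>
        Real.cosh q.2 ^ (-(((n : ℝ) - 2) / 2))) q :=
      contDiffAt_snd.cosh.rpow_const_of_ne (Real.cosh_pos _).ne'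
    exact (h1.mul ((hvX (cylMap_ne_zero hq) (inv_norm_smul_cylMap_ne hq)).comp q
      (contDiffAt_cylMap hq))).contDiffWithinAt
  · exact fun q hq => mul_pos (Real.rpow_pos_of_pos (Real.cosh_pos _) _)
      (hpos _ (hXn hq) (inv_norm_smul_cylMap_ne hq))
  · intro c hc q
    simp only [cylMap_smul hc, sphExt_smul v c hc]
  · rintro ⟨y, t⟩ hy
    have hy : y ≠ 0 := hy
    have hX : cylMap n (y, t) ≠ 0 := cylMap_ne_zero hy
    have hXN := inv_norm_smul_cylMap_ne (q := (y, t)) hy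
    have hθ := hXn (q := (y, t)) hy
    have hcosh := Real.cosh_pos t
    have hr : 0 < ‖y‖ := norm_pos_iff.2 hy
    rw [cylLaplacian_cyl (by ring) hy (hvX hX hXN) (sphExt_smul v),
      eLaplacian_eq_mul_of_hom (inv_pos.2 (norm_pos_iff.2 hX)) (hvX hX hXN)
        (hvX (norm_ne_zero_iff.1 (by simp [hθ])) (by simpa [hθ] using hXN)) (sphExt_smul v)]
    have h1 := heq _ hθ hXN
    have h2 : sphLaplacian v (‖cylMap n (y, t)‖⁻¹ • cylMap n (y, t))
      = eLaplacian (sphExt v) (‖cylMap n (y, t)‖⁻¹ • cylMap n (y, t)) := rfl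
    have h3 : 0 < sphExt v (cylMap n (y, t)) := hpos _ hθ hXN
    change -(_ - _ * sphExt v (cylMap n (y, t))) = sphExt K (cylMap n (y, t)) *
      sphExt v (cylMap n (y, t)) ^ _ at h1
    have h4 : (Real.cosh t ^ (-(((n : ℝ) - 2) / 2))) ^ (((n : ℝ) + 2) / ((n : ℝ) - 2))
        = Real.cosh t ^ (-(((n : ℝ) - 2) / 2)) / Real.cosh t ^ 2 := by
      rw [← Real.rpow_mul hcosh.le, ← Real.rpow_natCast, ← Real.rpow_sub hcosh]
      congr 1
      have : (n : ℝ) - 2 ≠ 0 := by linarith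
      push_cast
      field_simp
      ring
    rw [← h2]
    generalize sphLaplacian v (‖cylMap n (y, t)‖⁻¹ • cylMap n (y, t)) = Λ at h1 ⊢
    have h5 : ‖cylMap n (y, t)‖⁻¹ ^ 2 * (‖y‖ ^ 2 * Λ) = Λ / Real.cosh t ^ 2 := by
      rw [norm_cylMap]
      field_simp
    simp only
    rw [Real.mul_rpow (Real.rpow_nonneg hcosh.le _) h3.le, h4, mul_left_comm (‖y‖ ^ 2), h5]
    linear_combination (-(Real.cosh t ^ (-(((n : ℝ) - 2) / 2)) / Real.cosh t ^ 2)) * h1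
  · rw [lt_div_iff₀ (by linarith)]
    linarith
  · obtain ⟨θ, hθ, hθn, hθs, hθd⟩ := hK_ne
    obtain ⟨y, t₀, hy, rfl⟩ := exists_cylMap_eq hθ hθn hθs
    intro l
    refine ⟨(y, max l (max t₀ (2 * l - t₀)) + 1), hy, ?_, ?_⟩
    · simp only
      linarith [le_max_left l (max t₀ (2 * l - t₀))]
    · have h1 := le_max_right l (max t₀ (2 * l - t₀))
      have h2 := le_max_left t₀ (2 * l - t₀)
      have h3 := le_max_right t₀ (2 * l - t₀)
      refine lt_of_hasDerivAt_ne_zero (hasDerivAt_sphExt_cylMap hK hy) (hmono y hy) (t₀ := t₀)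
        (by linarith) (by linarith) ?_
      simpa [hθ] using hθd
  · intro ε hε
    obtain ⟨c, B, -, hB, hcB⟩ := exists_bounds_lower_hemisphere hv hpos
    have h1 : Tendsto Real.cosh atBot atTop := by
      refine tendsto_atTop_mono (f := fun t => Real.exp (-t) / 2) (fun t => ?_)
        ((Real.tendsto_exp_atTop.comp tendsto_neg_atBot_atTop).atTop_div_const two_pos)
      rw [Real.cosh_eq]
      linarith [Real.exp_pos t]
    have h2 : Tendsto (fun t => Real.cosh t ^ (-(((n : ℝ) - 2) / 2)) * B) atBot (𝓝 (0 * B)) :=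
      ((tendsto_rpow_neg_atTop (by linarith)).comp h1).mul_const B
    rw [zero_mul] at h2
    obtain ⟨T, hT⟩ := eventually_atBot.1 (h2.eventually (gt_mem_nhds hε))
    refine ⟨min T 0, fun q hq hqT => ?_⟩
    refine le_trans ?_ (hT q.2 (hqT.trans (min_le_left _ _))).le
    refine mul_le_mul_of_nonneg_left (hcB _ (hXn hq) ?_).2
      (Real.rpow_nonneg (Real.cosh_pos _).le _)
    have : Real.sinh q.2 ≤ 0 := Real.sinh_nonpos_iff.2 (hqT.trans (min_le_right _ _))
    simp only [cylMap, PiLp.smul_apply, appendLast_last, smul_eq_mul]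
    exact mul_nonpos_of_nonneg_of_nonpos (by positivity)
      (mul_nonpos_of_nonneg_of_nonpos (by positivity) this)

theorem exists_lower_bound (hn : 3 ≤ n)
    (hK : ContDiffOn ℝ 1 (sphExt K) {x | x ≠ 0})
    (hK_mono : ∀ θ, ‖θ‖ = 1 → 0 ≤ fderiv ℝ (sphExt K) θ (EuclideanSpace.single (Fin.last n) 1))
    (hK_ne : ∃ θ, ‖θ‖ = 1 ∧ θ ≠ EuclideanSpace.single (Fin.last n) 1 ∧
      θ ≠ -EuclideanSpace.single (Fin.last n) 1 ∧
      fderiv ℝ (sphExt K) θ (EuclideanSpace.single (Fin.last n) 1) ≠ 0)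
    (hv : ContDiffOn ℝ 2 (sphExt v)
      {x | x ≠ 0 ∧ ‖x‖⁻¹ • x ≠ EuclideanSpace.single (Fin.last n) 1})
    (hpos : ∀ θ, ‖θ‖ = 1 → θ ≠ EuclideanSpace.single (Fin.last n) 1 → 0 < v θ)
    (heq : ∀ θ, ‖θ‖ = 1 → θ ≠ EuclideanSpace.single (Fin.last n) 1 →
      -(sphLaplacian v θ - ((n : ℝ) * ((n : ℝ) - 2) / 4) * v θ)
        = K θ * v θ ^ (((n : ℝ) + 2) / ((n : ℝ) - 2))) :
    ∃ C₀ : ℝ, 0 < C₀ ∧ ∀ θ, ‖θ‖ = 1 → θ ≠ EuclideanSpace.single (Fin.last n) 1 →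
      C₀ * Real.arccos (θ (Fin.last n)) ^ (-(((n : ℝ) - 2) / 2)) ≤ v θ := by
  have hn' : (3 : ℝ) ≤ n := by exact_mod_cast hn
  obtain ⟨M, hw⟩ := exists_isCylinderSolution hn hK hK_mono hK_ne hv hpos heq
  obtain ⟨c, B, hc, -, hcB⟩ := exists_bounds_lower_hemisphere hv hpos
  refine ⟨c, hc, fun θ hθ hθn => ?_⟩
  rcases le_or_gt (θ (Fin.last n)) 0 with h0 | h0
  · have h1 : Real.pi / 2 ≤ Real.arccos (θ (Fin.last n)) :=
      not_lt.1 fun h => h0.not_gt (Real.arccos_lt_pi_div_two.1 h)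
    have h2 : Real.arccos (θ (Fin.last n)) ^ (-(((n : ℝ) - 2) / 2)) ≤ 1 :=
      Real.rpow_le_one_of_one_le_of_nonpos (by linarith [Real.pi_gt_three]) (by linarith)
    exact (mul_le_of_le_one_right hc.le h2).trans (hcB θ hθ h0).1
  · have hθs : θ ≠ -EuclideanSpace.single (Fin.last n) 1 := by
      rintro rfl
      norm_num at h0
    obtain ⟨y, t, hy, rfl⟩ := exists_cylMap_eq hθ hθn hθs
    have hr : 0 < ‖y‖ := norm_pos_iff.2 hy
    have hcosh := Real.cosh_pos t
    have hnorm := norm_cylMap (n := n) (y, t)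
    rw [hθ] at hnorm
    simp only at hnorm
    have hlast : cylMap n (y, t) (Fin.last n) = ‖y‖ * Real.sinh t := by simp [cylMap]
    rw [hlast] at h0 ⊢
    have ht : 0 ≤ t := Real.sinh_nonneg_iff.1 (pos_of_mul_pos_right h0 hr.le).le
    have hmon := hw.monotone (by omega) hy ht
    simp only [Real.cosh_zero, Real.one_rpow, one_mul] at hmon
    rw [sphExt_of_norm_eq_one v hθ] at hmon
    have h0' : cylMap n (y, 0) ≠ 0 := cylMap_ne_zero hy
    have h3 : c ≤ sphExt v (cylMap n (y, 0)) :=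
      (hcB _ (norm_inv_norm_smul h0') (by simp [cylMap])).1
    have h4 : Real.sin (Real.arccos (‖y‖ * Real.sinh t)) = ‖y‖ := by
      rw [Real.sin_arccos, ← Real.sqrt_sq hr.le]
      congr 1
      rw [Real.sqrt_sq hr.le, mul_pow, Real.sinh_sq]
      linear_combination (1 + ‖y‖ * Real.cosh t) * hnorm
    have h5 : ‖y‖ ≤ Real.arccos (‖y‖ * Real.sinh t) :=
      h4.symm.le.trans (Real.sin_le (Real.arccos_nonneg _))
    have h6 : Real.arccos (‖y‖ * Real.sinh t) ^ (-(((n : ℝ) - 2) / 2))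
        ≤ ‖y‖ ^ (-(((n : ℝ) - 2) / 2)) :=
      Real.rpow_le_rpow_of_nonpos hr h5 (by linarith)
    have h7 : Real.cosh t ^ (-(((n : ℝ) - 2) / 2)) * ‖y‖ ^ (-(((n : ℝ) - 2) / 2)) = 1 := by
      rw [← Real.mul_rpow hcosh.le hr.le, mul_comm, ← hnorm, Real.one_rpow]
    have h8 : 0 < Real.cosh t ^ (-(((n : ℝ) - 2) / 2)) := Real.rpow_pos_of_pos hcosh _
    refine (mul_le_mul_of_nonneg_left h6 hc.le).trans ?_
    refine le_of_mul_le_mul_left ?_ h8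
    calc _ = c := by rw [mul_left_comm, h7, mul_one]
      _ ≤ _ := h3.trans hmon

theorem not_bounded_of_lower_bound (hn : 3 ≤ n) {C₀ B : ℝ} (hC : 0 < C₀)
    (h : ∀ θ, ‖θ‖ = 1 → θ ≠ EuclideanSpace.single (Fin.last n) 1 →
      C₀ * Real.arccos (θ (Fin.last n)) ^ (-(((n : ℝ) - 2) / 2)) ≤ v θ)
    (hB : ∀ θ, ‖θ‖ = 1 → |v θ| ≤ B) : False := by
  have hn' : (3 : ℝ) ≤ n := by exact_mod_cast hn
  have h1 := (tendsto_rpow_neg_nhdsGT_zero (y := -(((n : ℝ) - 2) / 2))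
    (by linarith)).eventually (eventually_gt_atTop (B / C₀))
  obtain ⟨δ, hδB, hδ0, hδ1⟩ := (h1.and (Ioo_mem_nhdsGT one_pos)).exists
  have hsin : 0 < Real.sin δ :=
    Real.sin_pos_of_pos_of_lt_pi hδ0 (by linarith [Real.pi_gt_three])
  let i : Fin n := ⟨0, by omega⟩
  let θ := appendLast n (EuclideanSpace.single i (Real.sin δ), Real.cos δ)
  have hθ : ‖θ‖ = 1 := by
    rw [← sq_eq_sq₀ (norm_nonneg _) zero_le_one, norm_appendLast_sq]
    simp
  have hθn : θ ≠ EuclideanSpace.single (Fin.last n) 1 := by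
    intro hh
    have := congrArg (fun x : EuclideanSpace ℝ (Fin (n + 1)) => x i.castSucc) hh
    simp [θ] at this
    exact hsin.ne' this
  have h2 := h θ hθ hθn
  have h3 : θ (Fin.last n) = Real.cos δ := by simp [θ]
  rw [h3, Real.arccos_cos hδ0.le (by linarith [Real.pi_gt_three])] at h2
  rw [div_lt_iff₀ hC] at hδB
  linarith [le_abs_self (v θ), hB θ hθ]

end Sphere

end

theorem stmt17 (n : ℕ) (hn : 3 ≤ n)
    (S : Set (EuclideanSpace ℝ (Fin (n + 1))))
    (hS : S = Metric.sphere (0 : EuclideanSpace ℝ (Fin (n + 1))) 1)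
    (north south : EuclideanSpace ℝ (Fin (n + 1)))
    (hnorth : north = EuclideanSpace.single (Fin.last n) 1)
    (hsouth : south = -north)
    (K : EuclideanSpace ℝ (Fin (n + 1)) → ℝ)
    -- K ∈ C¹(Sⁿ), via its degree-zero homogeneous extension K̃
    (hK : ContDiffOn ℝ 1 (fun x => K (‖x‖⁻¹ • x)) {x | x ≠ 0})
    -- D K̃(θ)[e_{n+1}] ≥ 0 on Sⁿ
    (hK_mono : ∀ θ ∈ S,
      0 ≤ fderiv ℝ (fun x => K (‖x‖⁻¹ • x)) θ (EuclideanSpace.single (Fin.last n) 1))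
    -- D K̃(θ)[e_{n+1}] is not identically zero on Sⁿ \ {n, s}
    (hK_ne : ∃ θ ∈ S \ {north, south},
      fderiv ℝ (fun x => K (‖x‖⁻¹ • x)) θ (EuclideanSpace.single (Fin.last n) 1) ≠ 0) :
    -- the lower bound for singular solutions
    (∀ v : EuclideanSpace ℝ (Fin (n + 1)) → ℝ,
      ContDiffOn ℝ 2 (fun x => v (‖x‖⁻¹ • x)) {x | x ≠ 0 ∧ ‖x‖⁻¹ • x ≠ north} →
      (∀ θ ∈ S \ {north}, 0 < v θ) →
      (∀ θ ∈ S \ {north},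
        -(sphLaplacian v θ - ((n : ℝ) * ((n : ℝ) - 2) / 4) * v θ)
          = K θ * v θ ^ (((n : ℝ) + 2) / ((n : ℝ) - 2))) →
      (∃ c : ℝ, 0 < c ∧ ∀ᶠ θ in nhdsWithin north (S \ {north}), c ≤ v θ) →
      ∃ C₀ : ℝ, 0 < C₀ ∧ ∀ θ ∈ S \ {north},
        C₀ * Real.arccos (θ (Fin.last n)) ^ (-(((n : ℝ) - 2) / 2)) ≤ v θ) ∧
    -- in particular, no C²(Sⁿ) solutions
    (¬ ∃ v : EuclideanSpace ℝ (Fin (n + 1)) → ℝ,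
        ContDiffOn ℝ 2 (fun x => v (‖x‖⁻¹ • x)) {x | x ≠ 0} ∧
        (∀ θ ∈ S, 0 < v θ) ∧
        (∀ θ ∈ S,
          -(sphLaplacian v θ - ((n : ℝ) * ((n : ℝ) - 2) / 4) * v θ)
            = K θ * v θ ^ (((n : ℝ) + 2) / ((n : ℝ) - 2)))) := by
  subst hS hnorth hsouth
  simp only [mem_sphere_zero_iff_norm, Set.mem_sdiff, Set.mem_singleton_iff, Set.mem_insert_iff,
    not_or, and_imp] at hK_mono hK_ne ⊢
  obtain ⟨θ₀, ⟨hθ₀, hθn, hθs⟩, hθd⟩ := hK_ne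
  have hK_ne' : ∃ θ, ‖θ‖ = 1 ∧ θ ≠ EuclideanSpace.single (Fin.last n) 1 ∧
      θ ≠ -EuclideanSpace.single (Fin.last n) 1 ∧
      fderiv ℝ (sphExt K) θ (EuclideanSpace.single (Fin.last n) 1) ≠ 0 :=
    ⟨θ₀, hθ₀, hθn, hθs, hθd⟩
  refine ⟨fun v hv hpos heq _ => exists_lower_bound hn hK hK_mono hK_ne' hv hpos heq, ?_⟩
  rintro ⟨v, hv, hpos, heq⟩
  obtain ⟨C₀, hC, h⟩ := exists_lower_bound hn hK hK_mono hK_ne' (hv.mono fun x hx => hx.1)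
    (fun θ hθ _ => hpos θ hθ) (fun θ hθ _ => heq θ hθ)
  obtain ⟨B, -, hB⟩ := exists_abs_le_of_continuousOn_sphExt hv.continuousOn
  exact not_bounded_of_lower_bound hn hC h hB
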